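/- Let F be a field of characteristic p ≠ 2 and let λ be a partition of n+1. Then the blocks of the endomorphism algebra End_{FΣ_n}(S^λ↓_{Σ_n}) are parametrized by the p-residues of the removable nodes of [λ]: for each p-residue r of a removable node of λ, the corresponding block is isomorphic as an F-algebra to the truncated polynomial ring F[x]/(x^m), where m is the number of removable nodes of [λ] with p-residue r; in particular its F-dimension equals m. -/

import Mathlib

namespace CarterPayne

open Finset

/-- A partition of `n`, presented by its parts function; rows are indexed from `1`. -/
structure Partition (n : ℕ) where
  parts : ℕ → ℕ
  parts_zero : parts 0 = 0
  antitone : ∀ ⦃i j : ℕ⦄, 0 < i → i ≤ j → parts j ≤ parts i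
  finite_support : (Function.support parts).Finite
  sum_parts : ∑ᶠ i, parts i = n

variable {n : ℕ}

/-- The set of cells `(row, column)` (both 1-indexed) of the Young diagram of `μ`. -/
def Partition.cells (μ : Partition n) : Set (ℕ × ℕ) :=
  {c | 0 < c.1 ∧ 0 < c.2 ∧ c.2 ≤ μ.parts c.1}

/-- A tabloid for the composition `c` of `n`: an assignment of the `n` symbols to rows
(rows indexed from 1), row `i` receiving exactly `c i` symbols. -/
def Tabloid (n : ℕ) (c : ℕ → ℕ) : Type :=
  {g : Fin n → ℕ // ∀ i, (Finset.univ.filter fun k => g k = i).card = c i}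

/-- The permutation module `M^c` over `R`: the free `R`-module on the set of tabloids. -/
abbrev PermMod (R : Type*) [CommRing R] (n : ℕ) (c : ℕ → ℕ) := Tabloid n c →₀ R

/-- The action of a permutation of the symbols on tabloids. -/
def permTabloid (c : ℕ → ℕ) (π : Equiv.Perm (Fin n)) (f : Tabloid n c) : Tabloid n c :=
  ⟨fun k => f.1 (π.symm k), fun i => by
    rw [← f.2 i]
    exact Finset.card_equiv π.symm fun a => by simp⟩

/-- The `R`-linear action of a permutation of the symbols on `M^c`. -/
noncomputable def permM (R : Type*) [CommRing R] (c : ℕ → ℕ) (π : Equiv.Perm (Fin n)) :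
    PermMod R n c →ₗ[R] PermMod R n c :=
  Finsupp.lmapDomain R R (permTabloid c π)

/-- A bijective `μ`-tableau, presented by the placement map which sends each of the
`n` symbols to the cell of the Young diagram containing it. -/
structure Placement (μ : Partition n) where
  pos : Fin n → ℕ × ℕ
  mem : ∀ k, pos k ∈ μ.cells
  inj : Function.Injective pos
  surj : ∀ c ∈ μ.cells, ∃ k, pos k = c

/-- The column stabilizer of a bijective tableau, as a set of permutations of the symbols. -/
def colStab {μ : Partition n} (T : Placement μ) : Finset (Equiv.Perm (Fin n)) :=
  Finset.univ.filter fun π => ∀ k, (T.pos (π k)).2 = (T.pos k).2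

lemma rowFiber_card {μ : Partition n} (T : Placement μ) (i : ℕ) :
    (Finset.univ.filter fun k => (T.pos k).1 = i).card = μ.parts i := by
  classical
  have h : (Finset.univ.filter fun k => (T.pos k).1 = i).card
      = (Finset.Icc 1 (μ.parts i)).card := by
    apply Finset.card_bij (fun k _ => (T.pos k).2)
    · intro a ha
      simp only [Finset.mem_filter, Finset.mem_univ, true_and] at ha
      obtain ⟨h1, h2, h3⟩ := T.mem a
      exact Finset.mem_Icc.mpr ⟨h2, ha ▸ h3⟩
    · intro a ha b hb hab
      simp only [Finset.mem_filter, Finset.mem_univ, true_and] at ha hb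
      exact T.inj (Prod.ext (ha.trans hb.symm) hab)
    · intro j hj
      rw [Finset.mem_Icc] at hj
      have hi0 : 0 < i := by
        rcases Nat.eq_zero_or_pos i with h0 | h0
        · exfalso; rw [h0, μ.parts_zero] at hj; omega
        · exact h0
      obtain ⟨k, hk⟩ := T.surj (i, j) ⟨hi0, hj.1, hj.2⟩
      exact ⟨k, by simp [hk], by simp [hk]⟩
  rw [h, Nat.card_Icc]
  omega

/-- The row tabloid `{tπ}` associated to the bijective tableau `tπ`. -/
def rowTabloid {μ : Partition n} (T : Placement μ) (π : Equiv.Perm (Fin n)) :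
    Tabloid n μ.parts :=
  ⟨fun k => (T.pos (π k)).1, fun i => by
    rw [← rowFiber_card T i]
    exact Finset.card_equiv π fun a => by simp⟩

/-- The polytabloid `e_t` attached to a bijective tableau `t`. -/
noncomputable def polytabloid (R : Type*) [CommRing R] {μ : Partition n} (T : Placement μ) :
    PermMod R n μ.parts :=
  ∑ π ∈ colStab T, ((Equiv.Perm.sign π : ℤ) : R) • Finsupp.single (rowTabloid T π) (1 : R)

/-- The Specht module `S^μ`, the span in `M^μ` of all polytabloids. -/
noncomputable def Specht (R : Type*) [CommRing R] (μ : Partition n) :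
    Submodule R (PermMod R n μ.parts) :=
  Submodule.span R (Set.range fun T : Placement μ => polytabloid R T)

/-- `β` is obtained from the partition `α` of `n` by moving one box from
(the end of) row `a` to (the end of) row `b`; i.e. `β` is a one-box-shift of `α`. -/
structure OneBoxShift {n : ℕ} (α β : Partition n) (a b : ℕ) : Prop where
  a_pos : 0 < a
  a_lt_b : a < b
  rem : α.parts (a + 1) < α.parts a
  add : α.parts b < α.parts (b - 1)
  at_a : β.parts a = α.parts a - 1
  at_b : β.parts b = α.parts b + 1
  elsewhere : ∀ i, i ≠ a → i ≠ b → β.parts i = α.parts i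

/-- The rows of the removable nodes of `[λ]`, for `λ` a partition of `m`. -/
def remRows {m : ℕ} (lam : Partition m) : Finset ℕ :=
  (Finset.Icc 1 m).filter fun i => lam.parts (i + 1) < lam.parts i

/-- The endomorphism algebra `End_{FΣ_n}(S^λ↓_{Σ_n})` for `λ` a partition of `n+1`:
the `F`-subalgebra of `End_F(S^λ)` of endomorphisms which intertwine the action of
every permutation fixing the symbol `n+1`. -/
noncomputable def EndRes (F : Type*) [Field F] {n : ℕ} (lam : Partition (n + 1)) :
    Subalgebra F (Module.End F ↥(Specht F lam)) where
  carrier := {Φ | ∀ π : Equiv.Perm (Fin (n + 1)), π (Fin.last n) = Fin.last n →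
    ∀ x y : ↥(Specht F lam),
      (x : PermMod F (n + 1) lam.parts) = permM F lam.parts π (y : PermMod F (n + 1) lam.parts) →
      (Φ x : PermMod F (n + 1) lam.parts) = permM F lam.parts π (Φ y : PermMod F (n + 1) lam.parts)}
  mul_mem' := fun {f g} hf hg π hπ x y hxy => hf π hπ (g x) (g y) (hg π hπ x y hxy)
  one_mem' := fun π hπ x y hxy => hxy
  add_mem' := fun {f g} hf hg π hπ x y hxy => by
    simp only [LinearMap.add_apply, Submodule.coe_add, map_add,
      hf π hπ x y hxy, hg π hπ x y hxy]
  zero_mem' := fun π hπ x y hxy => by simp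
  algebraMap_mem' := fun c π hπ x y hxy => by
    simp only [Module.algebraMap_end_apply, SetLike.val_smul, map_smul, hxy]

/-- The `p`-residues of the removable nodes of `[λ]`. -/
noncomputable def remResSet {m : ℕ} (lam : Partition m) (p : ℕ) : Finset (ZMod p) :=
  (remRows lam).image fun i => (((lam.parts i : ℤ) - (i : ℤ) : ℤ) : ZMod p)

/-- The number of removable nodes of `[λ]` of `p`-residue `r`. -/
noncomputable def remResCount {m : ℕ} (lam : Partition m) (p : ℕ) (r : ZMod p) : ℕ :=
  ((remRows lam).filter fun i => (((lam.parts i : ℤ) - (i : ℤ) : ℤ) : ZMod p) = r).card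

section Uniq
variable {F : Type*} [Field F]

/-- The cells in column `c`, for column lengths `h`. -/
def Col (h : ℕ → ℕ) (c : ℕ) : Finset (ℕ × ℕ) := Icc 1 (h c) ×ˢ {c}

/-- The cells in the columns `d, …, M-1`. -/
def Reg (h : ℕ → ℕ) (M d : ℕ) : Finset (ℕ × ℕ) := (Ico d M).biUnion (Col h)

lemma mem_Col {h : ℕ → ℕ} {c : ℕ} {x : ℕ × ℕ} :
    x ∈ Col h c ↔ (1 ≤ x.1 ∧ x.1 ≤ h c) ∧ x.2 = c := by
  unfold Col
  rw [mem_product, mem_Icc, mem_singleton]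

lemma mem_Reg {h : ℕ → ℕ} {M d : ℕ} {x : ℕ × ℕ} :
    x ∈ Reg h M d ↔ (d ≤ x.2 ∧ x.2 < M) ∧ (1 ≤ x.1 ∧ x.1 ≤ h x.2) := by
  simp only [Reg, mem_biUnion, mem_Ico, mem_Col]
  constructor
  · rintro ⟨c, h1, h2, rfl⟩
    exact ⟨h1, h2⟩
  · rintro ⟨h1, h2⟩
    exact ⟨_, h1, h2, rfl⟩

lemma Col_subset_Reg {h : ℕ → ℕ} {M d c : ℕ} (h1 : d ≤ c) (h2 : c < M) : Col h c ⊆ Reg h M d := by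
  intro x hx
  rw [mem_Col] at hx
  rw [mem_Reg, hx.2]
  exact ⟨⟨h1, h2⟩, hx.1⟩

lemma Reg_eq {h : ℕ → ℕ} {M d : ℕ} (hd : d < M) :
    Reg h M d = Col h d ∪ Reg h M (d + 1) := by
  ext x
  simp only [mem_union, mem_Reg, mem_Col]
  constructor
  · rintro ⟨⟨h1, h2⟩, h3⟩
    rcases h1.eq_or_lt with e | e
    · left; rw [← e] at h3; exact ⟨h3, e.symm⟩
    · right; exact ⟨⟨e, h2⟩, h3⟩
  · rintro (⟨h1, h2⟩ | ⟨⟨h1, h2⟩, h3⟩)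
    · rw [← h2] at h1 hd ⊢; exact ⟨⟨le_rfl, hd⟩, h1⟩
    · exact ⟨⟨by omega, h2⟩, h3⟩

lemma Reg_disj {h : ℕ → ℕ} {M d : ℕ} : Disjoint (Col h d) (Reg h M (d + 1)) := by
  rw [Finset.disjoint_left]
  intro x h1 h2
  rw [mem_Col] at h1
  rw [mem_Reg] at h2
  omega

/-- Number of occurrences of the letter `i`. -/
def cnt (S : Finset (ℕ × ℕ)) (f : ℕ × ℕ → ℕ) (i : ℕ) : ℕ := (S.filter fun x => f x = i).card

lemma cnt_Reg {h : ℕ → ℕ} {M d : ℕ} (hd : d < M) (f : ℕ × ℕ → ℕ) (i : ℕ) :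
    cnt (Reg h M d) f i = cnt (Col h d) f i + cnt (Reg h M (d + 1)) f i := by
  unfold cnt
  rw [Reg_eq hd, filter_union, card_union_of_disjoint]
  exact disjoint_filter_filter Reg_disj

lemma cnt_congr {S : Finset (ℕ × ℕ)} {f g : ℕ × ℕ → ℕ} (hfg : ∀ x ∈ S, f x = g x) (i : ℕ) :
    cnt S f i = cnt S g i := by
  unfold cnt
  exact congrArg card (filter_congr (fun x hx => by rw [hfg x hx]))

lemma cnt_swap {S : Finset (ℕ × ℕ)} {x y : ℕ × ℕ} (hx : x ∈ S) (hy : y ∈ S) (f : ℕ × ℕ → ℕ)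
    (i : ℕ) : cnt S (f ∘ Equiv.swap x y) i = cnt S f i := by
  unfold cnt
  apply Finset.card_equiv (Equiv.swap x y)
  intro a
  simp only [mem_filter, Function.comp]
  have : Equiv.swap x y a ∈ S ↔ a ∈ S := by
    rw [Equiv.swap_apply_def]
    split_ifs with h1 h2
    · simp [h1, hx, hy]
    · simp [h2, hx, hy]
    · rfl
  rw [this]

lemma cnt_pos {S : Finset (ℕ × ℕ)} {f : ℕ × ℕ → ℕ} {x : ℕ × ℕ} (hx : x ∈ S) :
    0 < cnt S f (f x) := card_pos.mpr ⟨x, by simp [hx]⟩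

lemma cnt_fst_zero {h : ℕ → ℕ} {M d : ℕ} : cnt (Reg h M d) Prod.fst 0 = 0 := by
  unfold cnt
  rw [card_eq_zero, filter_eq_empty_iff]
  intro x hx
  rw [mem_Reg] at hx
  omega

lemma cnt_fst_large {h : ℕ → ℕ} (hh : Antitone h) {M d i : ℕ} (hi : h d < i) :
    cnt (Reg h M d) Prod.fst i = 0 := by
  unfold cnt
  rw [card_eq_zero, filter_eq_empty_iff]
  intro x hx
  rw [mem_Reg] at hx
  have := hh hx.1.1
  omega

/-- `f` has content `λ - e_b + *` on the columns `≥ d`. -/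
def Content (h : ℕ → ℕ) (M d b : ℕ) (f : ℕ × ℕ → ℕ) : Prop :=
  ∀ i, cnt (Reg h M d) f i + (if i = b then 1 else 0)
    = cnt (Reg h M d) Prod.fst i + (if i = 0 then 1 else 0)

/-- Functions of fillings which are alternating in columns. -/
structure Alt (h : ℕ → ℕ) (M d : ℕ) (v : (ℕ × ℕ → ℕ) → F) : Prop where
  congr : ∀ f g, (∀ x ∈ Reg h M d, f x = g x) → v f = v g
  alt : ∀ f c x y, d ≤ c → c < M → x ∈ Col h c → y ∈ Col h c → x ≠ y →
    v (f ∘ Equiv.swap x y) = - v f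

/-- Functions of fillings satisfying all relations. -/
structure Good (h : ℕ → ℕ) (M d b : ℕ) (v : (ℕ × ℕ → ℕ) → F) : Prop extends Alt h M d v where
  cont : ∀ f, v f ≠ 0 → Content h M d b f
  gar : ∀ f c c' x, d ≤ c → c < c' → c' < M → x ∈ Col h c' →
    v f = ∑ a ∈ Col h c, v (f ∘ Equiv.swap a x)
  rais : ∀ f i j, 1 ≤ i → i < j →
    ∑ x ∈ (Reg h M d).filter (fun x => f x = i), v (Function.update f x j) = 0

/-- Replace column `d` of `f` by the pattern `q`. -/
def glue (d : ℕ) (q : ℕ → ℕ) (f : ℕ × ℕ → ℕ) : ℕ × ℕ → ℕ := fun x => if x.2 = d then q x.1 else f x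

/-- The standard column with the letter `m` replaced by `*`. -/
def pm (m i : ℕ) : ℕ := if i = m then 0 else i

lemma Alt.zero_of_eq (h2 : (2 : F) ≠ 0) {h : ℕ → ℕ} {M d : ℕ} {v : (ℕ × ℕ → ℕ) → F}
    (hv : Alt h M d v) {f : ℕ × ℕ → ℕ} {c : ℕ} {x y : ℕ × ℕ} (hc : d ≤ c) (hM : c < M)
    (hx : x ∈ Col h c) (hy : y ∈ Col h c) (hxy : x ≠ y) (hf : f x = f y) : v f = 0 := by
  have h1 := hv.alt f c x y hc hM hx hy hxy
  have h3 : f ∘ Equiv.swap x y = f := by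
    ext z
    simp only [Function.comp, Equiv.swap_apply_def]
    split_ifs with e1 e2
    · rw [e1, hf]
    · rw [e2, hf]
    · rfl
  rw [h3] at h1
  have : (2 : F) * v f = 0 := by linear_combination h1
  simpa [h2] using this

lemma Alt.perm {h : ℕ → ℕ} {M d : ℕ} {v : (ℕ × ℕ → ℕ) → F}
    (hv : Alt h M d v) {c : ℕ} (hc : d ≤ c) (hM : c < M)
    (σ : Equiv.Perm {x // x ∈ Col h c}) : ∀ f : ℕ × ℕ → ℕ,
      v (f ∘ (Equiv.Perm.ofSubtype σ)) = 0 → v f = 0 := by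
  induction σ using Equiv.Perm.swap_induction_on' with
  | one => intro f hf; simpa using hf
  | mul_swap g x y hxy ih =>
    intro f hf
    apply ih
    rw [map_mul, Equiv.Perm.coe_mul, ← Function.comp_assoc, Equiv.Perm.ofSubtype_swap_eq,
      hv.alt _ c x.1 y.1 hc hM x.2 y.2 (fun e => hxy (Subtype.ext e))] at hf
    simpa using hf

lemma pm_inj {m i j : ℕ} (hi : 1 ≤ i) (hj : 1 ≤ j) (hij : pm m i = pm m j) : i = j := by
  unfold pm at hij
  split_ifs at hij <;> omega

lemma Alt.norm (h2 : (2 : F) ≠ 0) {h : ℕ → ℕ} {M d : ℕ} {v : (ℕ × ℕ → ℕ) → F}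
    (hv : Alt h M d v) (hd : d < M) {f : ℕ × ℕ → ℕ} (hf : v f ≠ 0)
    (hle : ∀ x ∈ Col h d, f x ≤ h d) : ∃ m ≤ h d, v (glue d (pm m) f) ≠ 0 := by
  classical
  have inj : ∀ x ∈ Col h d, ∀ y ∈ Col h d, f x = f y → x = y := by
    intro x hx y hy e
    by_contra hne
    exact hf (hv.zero_of_eq h2 le_rfl hd hx hy hne e)
  set S := (Col h d).image f with hS
  have hcol : (Col h d).card = h d := by simp [Col]
  have hcard : S.card = h d := by
    rw [hS, card_image_of_injOn, hcol]
    intro x hx y hy e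
    exact inj x hx y hy e
  have hsub : S ⊆ range (h d + 1) := by
    intro z hz
    rw [hS, mem_image] at hz
    obtain ⟨x, hx, rfl⟩ := hz
    rw [mem_range]
    have := hle x hx
    omega
  obtain ⟨m, hm⟩ : ∃ m, m ∈ range (h d + 1) \ S := by
    apply Finset.card_pos.mp
    rw [card_sdiff_of_subset hsub, hcard, card_range]
    omega
  rw [mem_sdiff, mem_range] at hm
  have hSe : S = (range (h d + 1)).erase m := by
    apply eq_of_subset_of_card_le
    · intro z hz
      rw [mem_erase]
      exact ⟨fun e => hm.2 (e ▸ hz), hsub hz⟩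
    · rw [card_erase_of_mem (mem_range.mpr hm.1), hcard, card_range]
      omega
  refine ⟨m, by omega, fun hzero => hf ?_⟩
  -- build the permutation
  let f1 : {x // x ∈ Col h d} → ℕ := fun x => f x.1
  let g1 : {x // x ∈ Col h d} → ℕ := fun x => pm m x.1.1
  have hf1 : Function.Injective f1 := fun x y e => Subtype.ext (inj _ x.2 _ y.2 e)
  have hg1 : Function.Injective g1 := by
    intro x y e
    have hx := mem_Col.mp x.2
    have hy := mem_Col.mp y.2
    have := pm_inj hx.1.1 hy.1.1 e
    exact Subtype.ext (Prod.ext this (hx.2.trans hy.2.symm))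
  have hg : ∀ x, ∃ y, f1 y = g1 x := by
    intro x
    have hx := mem_Col.mp x.2
    have : g1 x ∈ S := by
      rw [hSe, mem_erase, mem_range]
      show pm m x.1.1 ≠ m ∧ pm m x.1.1 < h d + 1
      unfold pm
      split_ifs <;> omega
    rw [hS, mem_image] at this
    obtain ⟨y, hy, e⟩ := this
    exact ⟨⟨y, hy⟩, e⟩
  choose s hs using hg
  have sinj : Function.Injective s := by
    intro x y e
    apply hg1
    rw [← hs, ← hs, e]
  let σ : Equiv.Perm {x // x ∈ Col h d} := Equiv.ofBijective s (Finite.injective_iff_bijective.mp sinj)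
  apply hv.perm le_rfl hd σ f
  rw [← hzero]
  apply hv.congr
  intro x hx
  unfold glue
  split_ifs with e
  · have hxc : x ∈ Col h d := by
      rw [mem_Reg] at hx
      rw [mem_Col]
      refine ⟨?_, e⟩
      rw [← e]; exact hx.2
    rw [Function.comp, Equiv.Perm.ofSubtype_apply_of_mem σ hxc]
    exact hs ⟨x, hxc⟩
  · have hxc : x ∉ Col h d := fun hh => e (mem_Col.mp hh).2
    rw [Function.comp, Equiv.Perm.ofSubtype_apply_of_not_mem σ hxc]

lemma glue_swap {h : ℕ → ℕ} {d c c' : ℕ} {x y : ℕ × ℕ} (hx : x ∈ Col h c) (hy : y ∈ Col h c')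
    (hc : d + 1 ≤ c) (hc' : d + 1 ≤ c') (q : ℕ → ℕ) (f : ℕ × ℕ → ℕ) :
    glue d q (f ∘ Equiv.swap x y) = glue d q f ∘ Equiv.swap x y := by
  have hx := (mem_Col.mp hx).2
  have hy := (mem_Col.mp hy).2
  funext z
  simp only [glue, Function.comp]
  by_cases e1 : z = x
  · subst e1
    rw [Equiv.swap_apply_left, if_neg (by omega), if_neg (by omega)]
  · by_cases e2 : z = y
    · subst e2
      rw [Equiv.swap_apply_right, if_neg (by omega), if_neg (by omega)]
    · rw [Equiv.swap_apply_of_ne_of_ne e1 e2]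

lemma glue_congr {h : ℕ → ℕ} {M d : ℕ} {q : ℕ → ℕ} {f g : ℕ × ℕ → ℕ}
    (hfg : ∀ x ∈ Reg h M (d + 1), f x = g x) : ∀ x ∈ Reg h M d, glue d q f x = glue d q g x := by
  intro x hx
  unfold glue
  split_ifs with e
  · rfl
  · apply hfg
    rw [mem_Reg] at hx ⊢
    exact ⟨⟨by omega, hx.1.2⟩, hx.2⟩

lemma Alt.glue {h : ℕ → ℕ} {M d : ℕ} {v : (ℕ × ℕ → ℕ) → F}
    (hv : Alt h M d v) (q : ℕ → ℕ) : Alt h M (d + 1) (fun f => v (glue d q f)) where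
  congr f g hfg := hv.congr _ _ (glue_congr hfg)
  alt f c x y hc hM hx hy hxy := by
    show v _ = - v _
    rw [glue_swap hx hy hc hc]
    exact hv.alt _ c x y (by omega) hM hx hy hxy

lemma cnt_glue {h : ℕ → ℕ} {M d : ℕ} (hd : d < M) (q : ℕ → ℕ) (f : ℕ × ℕ → ℕ) (i : ℕ) :
    cnt (Reg h M d) (glue d q f) i
      = ((Icc 1 (h d)).filter fun k => q k = i).card + cnt (Reg h M (d + 1)) f i := by
  rw [cnt_Reg hd]
  congr 1
  · unfold cnt
    symm
    apply card_bij (fun k _ => (k, d))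
    · intro a ha
      rw [mem_filter, mem_Icc] at ha
      rw [mem_filter, mem_Col]
      refine ⟨⟨ha.1, rfl⟩, ?_⟩
      unfold glue
      rw [if_pos rfl]
      exact ha.2
    · intro a _ b _ e
      exact (Prod.ext_iff.mp e).1
    · intro x hx
      rw [mem_filter, mem_Col] at hx
      refine ⟨x.1, ?_, Prod.ext rfl hx.1.2.symm⟩
      rw [mem_filter, mem_Icc]
      refine ⟨hx.1.1, ?_⟩
      have h3 := hx.2
      unfold glue at h3
      rwa [if_pos hx.1.2] at h3
  · apply cnt_congr
    intro x hx
    rw [mem_Reg] at hx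
    unfold glue
    rw [if_neg (by omega)]

lemma cnt_row {h : ℕ → ℕ} {M d : ℕ} (hd : d < M) (i : ℕ) :
    cnt (Reg h M d) Prod.fst i
      = (if 1 ≤ i ∧ i ≤ h d then 1 else 0) + cnt (Reg h M (d + 1)) Prod.fst i := by
  have : cnt (Reg h M d) Prod.fst i = cnt (Reg h M d) (glue d id Prod.fst) i := by
    apply cnt_congr
    intro x hx
    unfold glue
    split_ifs <;> rfl
  rw [this, cnt_glue hd]
  congr 1
  rw [Finset.filter_eq' (Icc 1 (h d)) i |> fun e => (by simpa using e : (Icc 1 (h d)).filter (fun k => id k = i) = _)]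
  split_ifs with h1 h2 <;> simp_all

lemma card_pm {H m : ℕ} (hm : m ≤ H) (i : ℕ) :
    ((Icc 1 H).filter fun k => pm m k = i).card
      = if i ≤ H ∧ i ≠ m then 1 else 0 := by
  split_ifs with hi
  · rw [card_eq_one]
    by_cases h0 : i = 0
    · refine ⟨m, ?_⟩
      ext k
      rw [mem_filter, mem_Icc, mem_singleton]
      unfold pm
      constructor
      · rintro ⟨h1, h2⟩
        split_ifs at h2 <;> omega
      · rintro rfl
        rw [if_pos rfl]; omega
    · refine ⟨i, ?_⟩
      ext k
      rw [mem_filter, mem_Icc, mem_singleton]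
      unfold pm
      constructor
      · rintro ⟨h1, h2⟩
        split_ifs at h2 <;> omega
      · rintro rfl
        rw [if_neg hi.2]; omega
  · rw [card_eq_zero, filter_eq_empty_iff]
    intro k hk
    rw [mem_Icc] at hk
    unfold pm
    split_ifs <;> omega

end Uniq

section Uniq2
variable {F : Type*} [Field F]

lemma Reg_empty {h : ℕ → ℕ} {M d : ℕ} (hd : M ≤ d) : Reg h M d = ∅ := by
  ext x
  rw [mem_Reg]
  simp only [notMem_empty, iff_false]
  omega

lemma lemC (h2 : (2 : F) ≠ 0) {h : ℕ → ℕ} {M : ℕ} (hh : Antitone h) : ∀ k d, M ≤ d + k →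
    ∀ u : (ℕ × ℕ → ℕ) → F, Alt h M d u →
    (∀ f, u f ≠ 0 → ∀ i, cnt (Reg h M d) f i = cnt (Reg h M d) Prod.fst i) →
    u Prod.fst = 0 → ∀ f, u f = 0 := by
  intro k
  induction k with
  | zero =>
    intro d hd u hu _ h0 f
    rw [← h0]
    apply hu.congr
    rw [Reg_empty (by omega)]
    simp
  | succ k ih =>
    intro d hd u hu hc h0 f
    by_cases hdM : M ≤ d
    · exact ih d (by omega) u hu hc h0 f
    · by_contra hf
      obtain ⟨m, hm, hmf⟩ := hu.norm h2 (by omega) hf (by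
        intro x hx
        by_contra hlt
        have h3 := hc f hf (f x)
        rw [cnt_fst_large hh (by omega)] at h3
        have := cnt_pos (f := f) (Col_subset_Reg (M := M) le_rfl (by omega) hx)
        omega)
      have key : ∀ m ≤ h d, ∀ f, u (glue d (pm m) f) ≠ 0 → ∀ i,
          (if i ≤ h d ∧ i ≠ m then 1 else 0) + cnt (Reg h M (d + 1)) f i
            = (if 1 ≤ i ∧ i ≤ h d then 1 else 0) + cnt (Reg h M (d + 1)) Prod.fst i := by
        intro m hm f hf i
        have := hc _ hf i
        rwa [cnt_glue (by omega), cnt_row (by omega), card_pm hm] at this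
      have hm0 : m = 0 := by
        by_contra hne
        have := key m hm f hmf 0
        rw [cnt_fst_zero, if_pos ⟨by omega, by omega⟩, if_neg (by omega)] at this
        omega
      subst hm0
      apply hmf
      refine ih (d + 1) (by omega) (fun f => u (glue d (pm 0) f)) (hu.glue _) ?_ ?_ f
      · intro f hf i
        have := key 0 hm f hf i
        split_ifs at this <;> omega
      · show u _ = 0
        rw [← h0]
        apply hu.congr
        intro x hx
        rw [mem_Reg] at hx
        unfold glue pm
        split_ifs <;> omega

lemma Good.le {h : ℕ → ℕ} (hh : Antitone h) {M d b : ℕ} {v : (ℕ × ℕ → ℕ) → F}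
    (hv : Good h M d b v) {f : ℕ × ℕ → ℕ} (hf : v f ≠ 0) {x : ℕ × ℕ} (hx : x ∈ Reg h M d) :
    f x ≤ h d := by
  by_contra hlt
  have h3 := hv.cont f hf (f x)
  rw [cnt_fst_large hh (by omega), if_neg (show f x ≠ 0 by omega)] at h3
  have := cnt_pos (f := f) hx
  omega

lemma Good.content_glue {h : ℕ → ℕ} {M d b : ℕ} (hd : d < M) {v : (ℕ × ℕ → ℕ) → F}
    (hv : Good h M d b v) {m : ℕ} (hm : m ≤ h d) {f : ℕ × ℕ → ℕ} (hf : v (glue d (pm m) f) ≠ 0)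
    (i : ℕ) :
    (if i ≤ h d ∧ i ≠ m then 1 else 0) + cnt (Reg h M (d + 1)) f i + (if i = b then 1 else 0)
      = (if 1 ≤ i ∧ i ≤ h d then 1 else 0) + cnt (Reg h M (d + 1)) Prod.fst i
        + (if i = 0 then 1 else 0) := by
  have := hv.cont _ hf i
  rwa [cnt_glue hd, cnt_row hd, card_pm hm] at this

lemma glue_update {d : ℕ} {q : ℕ → ℕ} {f : ℕ × ℕ → ℕ} {x : ℕ × ℕ} (hx : x.2 ≠ d) (j : ℕ) :
    glue d q (Function.update f x j) = Function.update (glue d q f) x j := by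
  funext z
  by_cases hz : z = x
  · subst hz
    rw [Function.update_self]
    unfold glue
    rw [if_neg hx, Function.update_self]
  · rw [Function.update_of_ne hz]
    unfold glue
    rw [Function.update_of_ne hz]

lemma Good.rais_split {h : ℕ → ℕ} {M d b : ℕ} (hd : d < M) {v : (ℕ × ℕ → ℕ) → F}
    (hv : Good h M d b v) (q : ℕ → ℕ) (f : ℕ × ℕ → ℕ) {i j : ℕ} (hi : 1 ≤ i) (hij : i < j) :
    ∑ x ∈ (Col h d).filter (fun x => q x.1 = i), v (Function.update (glue d q f) x j)
    + ∑ x ∈ (Reg h M (d + 1)).filter (fun x => f x = i), v (glue d q (Function.update f x j)) = 0 := by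
  rw [← hv.rais (glue d q f) i j hi hij, Reg_eq hd, filter_union,
    sum_union (disjoint_filter_filter Reg_disj)]
  congr 1
  · apply sum_congr _ (fun _ _ => rfl)
    apply filter_congr
    intro x hx
    unfold glue
    rw [if_pos (mem_Col.mp hx).2]
  · apply sum_congr
    · apply filter_congr
      intro x hx
      rw [mem_Reg] at hx
      unfold glue
      rw [if_neg (by omega)]
    · intro x hx
      rw [mem_filter, mem_Reg] at hx
      rw [glue_update (by omega)]

lemma Content.swap {h : ℕ → ℕ} {M d b : ℕ} {f : ℕ × ℕ → ℕ} {x y : ℕ × ℕ} (hx : x ∈ Reg h M d)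
    (hy : y ∈ Reg h M d) : Content h M d b (f ∘ Equiv.swap x y) ↔ Content h M d b f := by
  unfold Content
  simp only [cnt_swap hx hy]

lemma Content.congr {h : ℕ → ℕ} {M d b : ℕ} {f g : ℕ × ℕ → ℕ} (hfg : ∀ x ∈ Reg h M d, f x = g x) :
    Content h M d b f ↔ Content h M d b g := by
  unfold Content
  simp only [cnt_congr hfg]

/-- The column term of the raising relation vanishes. -/
lemma Good.col_term (h2 : (2 : F) ≠ 0) {h : ℕ → ℕ} (hh : Antitone h) {M d b : ℕ} (hd : d < M)
    {v : (ℕ × ℕ → ℕ) → F} (hv : Good h M d b v) {m : ℕ} (f : ℕ × ℕ → ℕ) {i j : ℕ} (hi : 1 ≤ i)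
    (hij : i < j) (hjm : j ≠ m) {x : ℕ × ℕ} (hx : x ∈ Col h d) (hxi : pm m x.1 = i) :
    v (Function.update (glue d (pm m) f) x j) = 0 := by
  by_contra hne
  have hxr := Col_subset_Reg (M := M) le_rfl hd hx
  have h1 := hv.le hh hne hxr
  rw [Function.update_self] at h1
  have hx' := mem_Col.mp hx
  have hxi' : x.1 = i := by
    unfold pm at hxi
    split_ifs at hxi <;> omega
  have hxy : x ≠ (j, d) := by
    intro e
    rw [e] at hxi'
    simp only at hxi'
    omega
  apply hne
  refine hv.zero_of_eq h2 (c := d) le_rfl hd hx (y := (j, d)) (mem_Col.mpr ⟨⟨by omega, h1⟩, rfl⟩) hxy ?_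
  rw [Function.update_self, Function.update_of_ne hxy.symm]
  unfold glue pm
  rw [if_pos rfl, if_neg hjm]

/-- Case of equal column lengths: the restriction is good. -/
lemma Good.glue_zero (h2 : (2 : F) ≠ 0) {h : ℕ → ℕ} (hh : Antitone h) {M d b : ℕ} (hd : d < M)
    {v : (ℕ × ℕ → ℕ) → F} (hv : Good h M d b v) :
    Good h M (d + 1) b (fun f => v (glue d (pm 0) f)) where
  toAlt := hv.toAlt.glue _
  cont f hf i := by
    have := hv.content_glue hd (Nat.zero_le _) hf i
    split_ifs at this ⊢ <;> omega
  gar f c c' x hc hcc hM hx := by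
    show v _ = _
    rw [hv.gar (glue d (pm 0) f) c c' x (by omega) hcc hM hx]
    apply sum_congr rfl
    intro a ha
    rw [glue_swap ha hx hc (by omega)]
  rais f i j hi hij := by
    have := hv.rais_split hd (pm 0) f hi hij
    rw [sum_eq_zero, zero_add] at this
    · exact this
    · intro x hx
      rw [mem_filter] at hx
      exact hv.col_term h2 hh hd f hi hij (by omega) hx.1 hx.2

/-- Case of a shorter next column. -/
lemma Good.glue_top (h2 : (2 : F) ≠ 0) {h : ℕ → ℕ} (hh : Antitone h) {M d b : ℕ} (hd : d < M)
    {v : (ℕ × ℕ → ℕ) → F} (hv : Good h M d b v) (hlt : h (d + 1) < h d) 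
    (vh : (ℕ × ℕ → ℕ) → F)
    (h1 : ∀ f, Content h M (d + 1) b f →
      vh f = v (glue d (pm (h d)) (fun x => if f x = 0 then h d else f x)))
    (h0 : ∀ f, ¬ Content h M (d + 1) b f → vh f = 0) :
    Good h M (d + 1) b vh where
  congr f g hfg := by
    by_cases hc : Content h M (d + 1) b f
    · rw [h1 f hc, h1 g ((Content.congr hfg).mp hc)]
      apply hv.congr
      apply glue_congr
      intro x hx
      simp only [hfg x hx]
    · rw [h0 f hc, h0 g (fun h => hc ((Content.congr hfg).mpr h))]
  alt f c x y hc hM hx hy hxy := by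
    have hs := Content.swap (f := f) (b := b) (Col_subset_Reg (M := M) hc hM hx)
      (Col_subset_Reg (M := M) hc hM hy)
    by_cases hC : Content h M (d + 1) b f
    · rw [h1 f hC, h1 _ (hs.mpr hC), ← hv.alt _ c x y (by omega) hM hx hy hxy,
        ← glue_swap hx hy hc hc]
      rfl
    · rw [h0 f hC, h0 _ (fun h => hC (hs.mp h)), neg_zero]
  cont f hf := by
    by_contra hC
    exact hf (h0 f hC)
  gar f c c' x hc hcc hM hx := by
    have hs : ∀ a ∈ Col h c, (Content h M (d + 1) b (f ∘ Equiv.swap a x) ↔ _) := fun a ha =>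
      Content.swap (f := f) (b := b) (Col_subset_Reg (M := M) hc (by omega) ha)
      (Col_subset_Reg (M := M) (by omega) hM hx)
    by_cases hC : Content h M (d + 1) b f
    · rw [h1 f hC, hv.gar _ c c' x (by omega) hcc hM hx]
      apply sum_congr rfl
      intro a ha
      rw [h1 _ ((hs a ha).mpr hC), ← glue_swap ha hx hc (by omega)]
      rfl
    · rw [h0 f hC, sum_eq_zero]
      intro a ha
      exact h0 _ (fun h => hC ((hs a ha).mp h))
  rais f i j hi hij := by
    by_cases hall : ∀ x ∈ (Reg h M (d + 1)).filter (fun x => f x = i),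
        ¬ Content h M (d + 1) b (Function.update f x j)
    · exact sum_eq_zero fun x hx => h0 _ (hall x hx)
    · push Not at hall
      obtain ⟨x0, hx0, hC0⟩ := hall
      rw [mem_filter] at hx0
      have hj : j ≤ h (d + 1) := by
        by_contra hlt
        have h3 := hC0 j
        rw [cnt_fst_large hh (by omega), if_neg (show j ≠ 0 by omega)] at h3
        have := cnt_pos (f := Function.update f x0 j) hx0.1
        rw [Function.update_self] at this
        omega
      have hC : ∀ x ∈ (Reg h M (d + 1)).filter (fun x => f x = i),
          Content h M (d + 1) b (Function.update f x j) := by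
        intro x hx
        rw [mem_filter] at hx
        rw [← Content.swap hx0.1 hx.1] at hC0
        convert hC0 using 1
        funext z
        rw [Function.comp, Equiv.swap_apply_def]
        split_ifs with e1 e2
        · subst e1
          by_cases e : z = x
          · subst e; rfl
          · rw [Function.update_of_ne e, Function.update_of_ne (Ne.symm e), hx.2, hx0.2]
        · subst e2
          rw [Function.update_self, Function.update_self]
        · rw [Function.update_of_ne e1, Function.update_of_ne e2]
      have := hv.rais_split hd (pm (h d)) (fun x => if f x = 0 then h d else f x) hi hij
      rw [sum_eq_zero, zero_add] at this
      · rw [← this]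
        apply sum_congr
        · apply filter_congr
          intro x hx
          split_ifs <;> omega
        · intro x hx
          rw [mem_filter] at hx
          rw [h1 _ (hC x (mem_filter.mpr ⟨hx.1, by have := hx.2; split_ifs at this <;> omega⟩))]
          congr 2
          funext z
          by_cases e : z = x
          · subst e
            simp only [Function.update_self]
            rw [if_neg (by omega)]
          · simp only [Function.update_of_ne e]
      · intro x hx
        rw [mem_filter] at hx
        exact hv.col_term h2 hh hd _ hi hij (by omega) hx.1 hx.2

lemma step_eq (h2 : (2 : F) ≠ 0) {h : ℕ → ℕ} (hh : Antitone h) {M d b : ℕ} (hM0 : h M = 0)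
    (hd : d < M) {v : (ℕ × ℕ → ℕ) → F} (hv : Good h M d b v) (he : h (d + 1) = h d)
    (hb : 1 ≤ b) (hw0 : ∀ f, v (glue d (pm 0) f) = 0) {m : ℕ} (hm : m ≤ h d) (f : ℕ × ℕ → ℕ) :
    v (glue d (pm m) f) = 0 := by
  rcases Nat.eq_zero_or_pos m with rfl | hm1
  · exact hw0 f
  by_contra hne
  have hd1 : d + 1 < M := by
    by_contra hle
    have := hh (show M ≤ d + 1 by omega)
    omega
  have hc0 := hv.content_glue hd hm hne 0
  rw [if_pos ⟨by omega, by omega⟩, if_neg (by omega), cnt_fst_zero] at hc0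
  have hcol : ∀ x ∈ Col h (d + 1), glue d (pm m) f x = f x := by
    intro x hx
    unfold glue
    rw [if_neg (by rw [(mem_Col.mp hx).2]; omega)]
  have hR : ∀ x ∈ Col h (d + 1), x ∈ Reg h M (d + 1) := fun x hx => Col_subset_Reg le_rfl hd1 hx
  have hpos : ∀ x ∈ Col h (d + 1), f x ∈ Icc 1 (h d) := by
    intro x hx
    rw [mem_Icc]
    constructor
    · by_contra h0
      have := cnt_pos (f := f) (hR x hx)
      rw [show f x = 0 by omega] at this
      split_ifs at hc0 <;> omega
    · rw [← hcol x hx]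
      exact hv.le hh hne (Col_subset_Reg (by omega) hd1 hx)
  have inj : ∀ x ∈ Col h (d + 1), ∀ y ∈ Col h (d + 1), f x = f y → x = y := by
    intro x hx y hy e
    by_contra hxy
    exact hne (hv.zero_of_eq h2 (by omega) hd1 hx hy hxy (by rw [hcol x hx, hcol y hy, e]))
  have himg : (Col h (d + 1)).image f = Icc 1 (h d) := by
    apply eq_of_subset_of_card_le
    · intro z hz
      rw [mem_image] at hz
      obtain ⟨x, hx, rfl⟩ := hz
      exact hpos x hx
    · rw [card_image_of_injOn (fun x hx y hy e => inj x hx y hy e)]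
      simp [Col, he]
  have hex : ∀ i ∈ Icc 1 (h d), ∃ x ∈ Col h (d + 1), f x = i := by
    intro i hi
    rw [← himg, mem_image] at hi
    exact hi
  obtain ⟨x, hx, hxm⟩ := hex m (mem_Icc.mpr ⟨hm1, hm⟩)
  have hx2 := (mem_Col.mp hx).2
  apply hne
  rw [hv.gar _ d (d + 1) x le_rfl (by omega) hd1 hx]
  apply sum_eq_zero
  intro a ha
  have ha' := mem_Col.mp ha
  have hax : a ≠ x := by
    rintro rfl
    omega
  by_cases ham : a.1 = m
  · rw [← hw0 (Function.update f x 0)]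
    congr 1
    funext z
    by_cases e1 : z = a
    · subst e1
      rw [Function.comp, Equiv.swap_apply_left, hcol x hx, hxm]
      unfold glue pm
      rw [if_pos ha'.2, if_neg (by omega), ham]
    · by_cases e2 : z = x
      · subst e2
        rw [Function.comp, Equiv.swap_apply_right]
        unfold glue pm
        rw [if_pos ha'.2, if_pos ham, if_neg (show ¬ z.2 = d by omega), Function.update_self]
      · rw [Function.comp, Equiv.swap_apply_of_ne_of_ne e1 e2]
        unfold glue
        rw [Function.update_of_ne e2]
        split_ifs with e3
        · have : z.1 ≠ m := fun e => e1 (Prod.ext (e.trans ham.symm) (e3.trans ha'.2.symm))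
          unfold pm
          split_ifs <;> omega
        · rfl
  · obtain ⟨y, hy, hya⟩ := hex a.1 (mem_Icc.mpr ha'.1)
    have hy2 := (mem_Col.mp hy).2
    have hyx : y ≠ x := by
      rintro rfl
      omega
    have hya' : y ≠ a := by
      rintro rfl
      omega
    refine hv.zero_of_eq h2 (c := d + 1) (by omega) hd1 hx hy hyx.symm ?_
    rw [Function.comp, Function.comp, Equiv.swap_apply_right, Equiv.swap_apply_of_ne_of_ne hya' hyx,
      hcol y hy, hya]
    unfold glue pm
    rw [if_pos ha'.2, if_neg ham]

lemma step_lt (h2 : (2 : F) ≠ 0) {h : ℕ → ℕ} {M d b : ℕ}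
    (hd : d < M) {v : (ℕ × ℕ → ℕ) → F} (hv : Good h M d b v)
    (hb : 1 ≤ b) (hwH : ∀ f, v (glue d (pm (h d)) f) = 0) {m : ℕ} (hm : m ≤ h d) (f : ℕ × ℕ → ℕ) :
    v (glue d (pm m) f) = 0 := by
  have hpos : ∀ m, 1 ≤ m → m ≤ h d → ∀ f, v (glue d (pm m) f) = 0 := by
    intro m hm1 hm f
    rcases hm.eq_or_lt with e | hlt
    · rw [e]; exact hwH f
    have := hv.rais_split hd (pm (h d)) f hm1 hlt
    rw [sum_eq_zero (s := (Reg h M (d + 1)).filter _) (fun x _ => hwH _), add_zero] at this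
    have hfil : (Col h d).filter (fun x => pm (h d) x.1 = m) = {(m, d)} := by
      ext x
      rw [mem_filter, mem_Col, mem_singleton]
      constructor
      · rintro ⟨⟨h1, h2⟩, h3⟩
        unfold pm at h3
        refine Prod.ext ?_ h2
        show x.1 = m
        split_ifs at h3 <;> omega
      · rintro rfl
        refine ⟨⟨⟨hm1, hm⟩, rfl⟩, ?_⟩
        unfold pm
        rw [if_neg (by omega)]
    rw [hfil, sum_singleton] at this
    have hne : (m, d) ≠ (h d, d) := fun e => by
      have := (Prod.ext_iff.mp e).1
      simp only at this
      omega
    have h3 := hv.alt (glue d (pm m) f) d (m, d) (h d, d) le_rfl hd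
      (mem_Col.mpr ⟨⟨hm1, hm⟩, rfl⟩) (mem_Col.mpr ⟨⟨by simp only; omega, le_rfl⟩, rfl⟩) hne
    have h4 : Function.update (glue d (pm (h d)) f) (m, d) (h d)
        = glue d (pm m) f ∘ Equiv.swap (m, d) (h d, d) := by
      funext z
      by_cases e1 : z = (m, d)
      · subst e1
        rw [Function.comp, Equiv.swap_apply_left, Function.update_self]
        unfold glue pm
        rw [if_pos rfl, if_neg]
        simp only
        omega
      · rw [Function.update_of_ne e1]
        by_cases e2 : z = (h d, d)
        · subst e2
          rw [Function.comp, Equiv.swap_apply_right]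
          unfold glue pm
          simp
        · rw [Function.comp, Equiv.swap_apply_of_ne_of_ne e1 e2]
          unfold glue
          split_ifs with e3
          · have n1 : z.1 ≠ m := fun e => e1 (Prod.ext e e3)
            have n2 : z.1 ≠ h d := fun e => e2 (Prod.ext e e3)
            unfold pm
            rw [if_neg n1, if_neg n2]
          · rfl
    rw [← h4, this] at h3
    simpa using h3.symm
  rcases Nat.eq_zero_or_pos m with rfl | hm1
  swap
  · exact hpos m hm1 hm f
  by_contra hne
  have hc0 := hv.content_glue hd hm hne 0
  rw [if_neg (by omega), if_neg (by omega), if_neg (by omega), if_pos rfl, cnt_fst_zero] at hc0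
  obtain ⟨x, hx⟩ : ∃ x, x ∈ (Reg h M (d + 1)).filter (fun x => f x = 0) := by
    apply Finset.card_pos.mp
    unfold cnt at hc0
    omega
  rw [mem_filter, mem_Reg] at hx
  apply hne
  rw [hv.gar _ d x.2 x le_rfl (by omega) hx.1.1.2 (mem_Col.mpr ⟨hx.1.2, rfl⟩)]
  apply sum_eq_zero
  intro a ha
  have ha' := mem_Col.mp ha
  rw [← hpos a.1 ha'.1.1 ha'.1.2 (Function.update f x a.1)]
  congr 1
  funext z
  by_cases e1 : z = a
  · subst e1
    rw [Function.comp, Equiv.swap_apply_left]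
    unfold glue pm
    rw [if_neg (by omega), if_pos ha'.2, if_pos rfl, hx.2]
  · by_cases e2 : z = x
    · subst e2
      rw [Function.comp, Equiv.swap_apply_right]
      unfold glue pm
      rw [if_pos ha'.2, if_neg (by omega), if_neg (by omega), Function.update_self]
    · rw [Function.comp, Equiv.swap_apply_of_ne_of_ne e1 e2]
      unfold glue
      rw [Function.update_of_ne e2]
      split_ifs with e3
      · have n1 : z.1 ≠ a.1 := fun e => e1 (Prod.ext e (e3.trans ha'.2.symm))
        unfold pm
        rw [if_neg n1]
        split_ifs <;> omega
      · rfl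

theorem uniq_main (h2 : (2 : F) ≠ 0) {h : ℕ → ℕ} (hh : Antitone h) {M b : ℕ} (hM0 : h M = 0)
    (hb : 1 ≤ b) : ∀ k d, M ≤ d + k → ∃ f0 : ℕ × ℕ → ℕ, ∀ v : (ℕ × ℕ → ℕ) → F, Good h M d b v →
      ((∃ c, d ≤ c ∧ c < M ∧ h c = b) → v f0 = 0) → ∀ f, v f = 0 := by
  classical
  have base : ∀ d, M ≤ d → ∃ f0 : ℕ × ℕ → ℕ, ∀ v : (ℕ × ℕ → ℕ) → F, Good h M d b v →
      ((∃ c, d ≤ c ∧ c < M ∧ h c = b) → v f0 = 0) → ∀ f, v f = 0 := by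
    intro d hd
    refine ⟨Prod.fst, fun v hv _ f => ?_⟩
    by_contra hne
    have := hv.cont f hne 0
    rw [Reg_empty hd, if_neg (by omega), if_pos rfl] at this
    simp [cnt] at this
  intro k
  induction k with
  | zero => intro d hd; exact base d (by omega)
  | succ k ih =>
    intro d hd
    by_cases hdM : M ≤ d
    · exact base d hdM
    have hdM : d < M := by omega
    have red : ∀ v : (ℕ × ℕ → ℕ) → F, Good h M d b v →
        (∀ m ≤ h d, ∀ f, v (glue d (pm m) f) = 0) → ∀ f, v f = 0 := by
      intro v hv hw f
      by_contra hne
      obtain ⟨m, hm, hmf⟩ := hv.norm h2 hdM hne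
        (fun x hx => hv.le hh hne (Col_subset_Reg le_rfl hdM hx))
      exact hmf (hw m hm f)
    obtain ⟨f0, hf0⟩ := ih (d + 1) (by omega)
    rcases (hh (Nat.le_succ d)).eq_or_lt with he | hlt
    · refine ⟨glue d (pm 0) f0, fun v hv hvf => red v hv ?_⟩
      intro m hm f
      refine step_eq h2 hh hM0 hdM hv he hb ?_ hm f
      exact hf0 _ (hv.glue_zero h2 hh hdM) (fun ⟨c, h1, h3, h4⟩ => hvf ⟨c, by omega, h3, h4⟩)
    · change h (d + 1) < h d at hlt
      by_cases hbh : b ≤ h (d + 1)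
      · refine ⟨glue d (pm (h d)) (fun x => if f0 x = 0 then h d else f0 x),
          fun v hv hvf => red v hv ?_⟩
        intro m hm f
        refine step_lt h2 hdM hv hb ?_ hm f
        clear f
        set vh : (ℕ × ℕ → ℕ) → F := fun f => if Content h M (d + 1) b f then
          v (glue d (pm (h d)) (fun x => if f x = 0 then h d else f x)) else 0 with hvh
        have g := hv.glue_top h2 hh hdM hlt vh (fun f hf => by simp only [hvh]; rw [if_pos hf])
          (fun f hf => by simp only [hvh]; rw [if_neg hf])
        have hz := hf0 vh g (fun ⟨c, h1, h3, h4⟩ => by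
          simp only [hvh]
          split_ifs
          · exact hvf ⟨c, by omega, h3, h4⟩
          · rfl)
        intro f
        by_contra hne
        have hc := hv.content_glue hdM le_rfl hne
        have hc0 := hc 0
        rw [if_pos ⟨by omega, by omega⟩, if_neg (by omega), if_neg (by omega), if_pos rfl,
          cnt_fst_zero] at hc0
        have hno : ∀ x ∈ Reg h M (d + 1), f x ≠ 0 := by
          intro x hx e
          have := cnt_pos (f := f) hx
          rw [e] at this
          omega
        have hC : Content h M (d + 1) b (fun x => if f x = h d then 0 else f x) := by
          intro i
          by_cases hi0 : i = 0
          · subst hi0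
            have : cnt (Reg h M (d + 1)) (fun x => if f x = h d then 0 else f x) 0
                = cnt (Reg h M (d + 1)) f (h d) := by
              unfold cnt
              congr 1
              apply filter_congr
              intro x hx
              have := hno x hx
              beta_reduce
              split_ifs with e
              · simp [e]
              · simp [e, this]
            rw [this]
            have h3 := hc (h d)
            rw [cnt_fst_large hh hlt] at h3
            rw [cnt_fst_zero]
            split_ifs at h3 ⊢ <;> omega
          · by_cases hiH : i = h d
            · have : cnt (Reg h M (d + 1)) (fun x => if f x = h d then 0 else f x) i = 0 := by
                unfold cnt
                rw [card_eq_zero, filter_eq_empty_iff]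
                intro x hx
                beta_reduce
                split_ifs <;> omega
              rw [this, cnt_fst_large hh (by omega)]
              split_ifs <;> omega
            · have : cnt (Reg h M (d + 1)) (fun x => if f x = h d then 0 else f x) i
                  = cnt (Reg h M (d + 1)) f i := by
                unfold cnt
                congr 1
                apply filter_congr
                intro x hx
                beta_reduce
                split_ifs <;> omega
              rw [this]
              have h3 := hc i
              split_ifs at h3 ⊢ <;> omega
        have h3 := hz (fun x => if f x = h d then 0 else f x)
        simp only [hvh] at h3
        rw [if_pos hC] at h3
        apply hne
        rw [← h3]
        apply hv.congr
        apply glue_congr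
        intro x hx
        have := hno x hx
        split_ifs <;> omega
      · refine ⟨glue d (pm (h d)) Prod.fst, fun v hv hvf => red v hv ?_⟩
        intro m hm f
        refine step_lt h2 hdM hv hb ?_ hm f
        clear f
        have hbH : ∀ f, v (glue d (pm (h d)) f) ≠ 0 → b = h d := by
          intro f hne
          by_contra hbne
          have hc := hv.content_glue hdM le_rfl hne b
          rw [cnt_fst_large hh (by omega)] at hc
          split_ifs at hc <;> omega
        by_cases hb' : b = h d
        · refine lemC h2 hh k (d + 1) (by omega) (fun f => v (glue d (pm (h d)) f))
            (hv.toAlt.glue _) ?_ ?_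
          · intro f hne i
            have hc := hv.content_glue hdM le_rfl hne i
            split_ifs at hc <;> omega
          · exact hvf ⟨d, le_rfl, hdM, hb'.symm⟩
        · intro f
          by_contra hne
          exact hb' (hbH f hne)

end Uniq2

section SpechtFacts
variable {R : Type*} [CommRing R] {N : ℕ} {μ : Partition N}

/-- Action of permutations on bijective tableaux. -/
def Placement.perm (T : Placement μ) (σ : Equiv.Perm (Fin N)) : Placement μ where
  pos k := T.pos (σ.symm k)
  mem k := T.mem _
  inj := T.inj.comp σ.symm.injective
  surj c hc := by
    obtain ⟨k, hk⟩ := T.surj c hc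
    exact ⟨σ k, by simpa using hk⟩

lemma mem_colStab {T : Placement μ} {π : Equiv.Perm (Fin N)} :
    π ∈ colStab T ↔ ∀ k, (T.pos (π k)).2 = (T.pos k).2 := by
  simp [colStab]

lemma colStab_symm {T : Placement μ} {π : Equiv.Perm (Fin N)} (h : π ∈ colStab T) (k : Fin N) :
    (T.pos (π.symm k)).2 = (T.pos k).2 := by
  rw [mem_colStab] at h
  rw [← h, Equiv.apply_symm_apply]

lemma colStab_mul {T : Placement μ} {π σ : Equiv.Perm (Fin N)} (h : π ∈ colStab T)
    (h' : σ ∈ colStab T) : π * σ ∈ colStab T := by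
  rw [mem_colStab] at *
  intro k
  rw [Equiv.Perm.mul_apply, h, h']

lemma colStab_swap {T : Placement μ} {a b : Fin N} (hab : (T.pos a).2 = (T.pos b).2) :
    Equiv.swap a b ∈ colStab T := by
  rw [mem_colStab]
  intro k
  rw [Equiv.swap_apply_def]
  split_ifs with h1 h2
  · rw [h1, hab]
  · rw [h2, hab]
  · rfl

lemma permM_single (c : ℕ → ℕ) (σ : Equiv.Perm (Fin N)) (τ : Tabloid N c) (r : R) :
    permM R c σ (Finsupp.single τ r) = Finsupp.single (permTabloid c σ τ) r := by
  simp [permM]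

lemma permM_poly (T : Placement μ) (σ : Equiv.Perm (Fin N)) :
    permM R μ.parts σ (polytabloid R T) = polytabloid R (T.perm σ) := by
  unfold polytabloid
  rw [map_sum]
  apply sum_bij (fun π _ => σ * π * σ⁻¹)
  · intro π hπ
    rw [mem_colStab] at hπ ⊢
    intro k
    simp [Placement.perm, hπ]
  · intro a _ b _ h
    simpa using h
  · intro π hπ
    refine ⟨σ⁻¹ * π * σ, ?_, by group⟩
    rw [mem_colStab] at hπ ⊢
    intro k
    have := hπ (σ k)
    simpa [Placement.perm] using this
  · intro π hπ
    rw [map_smul, permM_single]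
    congr 2
    · rw [map_mul, map_mul, Equiv.Perm.sign_inv, mul_comm, ← mul_assoc, Int.units_mul_self, one_mul]
    · apply Subtype.ext
      funext k
      simp [permTabloid, rowTabloid, Placement.perm]

lemma poly_col (T : Placement μ) {σ : Equiv.Perm (Fin N)} (hσ : σ ∈ colStab T) :
    polytabloid R (T.perm σ) = ((Equiv.Perm.sign σ : ℤ) : R) • polytabloid R T := by
  rw [← permM_poly]
  unfold polytabloid
  rw [map_sum, smul_sum]
  apply sum_bij (fun π _ => π * σ⁻¹)
  · intro π hπ
    apply colStab_mul hπ
    rw [mem_colStab]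
    exact colStab_symm hσ
  · intro a _ b _ h
    simpa using h
  · intro π hπ
    exact ⟨π * σ, colStab_mul hπ hσ, by simp⟩
  · intro π hπ
    rw [map_smul, permM_single, smul_smul]
    congr 2
    rw [map_mul, Equiv.Perm.sign_inv]
    push_cast
    rw [mul_comm, mul_assoc, ← Int.cast_mul, ← Units.val_mul, Int.units_mul_self]
    simp

lemma poly_swap (T : Placement μ) {a b : Fin N} (hne : a ≠ b) (hab : (T.pos a).2 = (T.pos b).2) :
    polytabloid R (T.perm (Equiv.swap a b)) = - polytabloid R T := by
  rw [poly_col T (colStab_swap hab), Equiv.Perm.sign_swap hne]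
  simp

/-- Single-node Garnir relation. -/
lemma garnir (T : Placement μ) (x : Fin N) (c : ℕ) (hc : 1 ≤ c) (hcx : c < (T.pos x).2) :
    polytabloid R T = ∑ a ∈ univ.filter (fun a => (T.pos a).2 = c),
      polytabloid R (T.perm (Equiv.swap a x)) := by
  classical
  have hex : ∀ π ∈ colStab T, ∃ a, (T.pos a).2 = c ∧ T.pos (π a) = ((T.pos (π x)).1, c) := by
    intro π hπ
    obtain ⟨k, hk⟩ := T.surj ((T.pos (π x)).1, c) (by
      have h := T.mem (π x)
      refine ⟨h.1, hc, ?_⟩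
      have h3 := h.2.2
      rw [mem_colStab.mp hπ] at h3
      simp only
      omega)
    refine ⟨π.symm k, ?_, by simpa using hk⟩
    rw [colStab_symm hπ, hk]
  have hex' : ∀ π : Equiv.Perm (Fin N), ∃ a, π ∈ colStab T →
      (T.pos a).2 = c ∧ T.pos (π a) = ((T.pos (π x)).1, c) := by
    intro π
    by_cases hπ : π ∈ colStab T
    · obtain ⟨a, ha⟩ := hex π hπ
      exact ⟨a, fun _ => ha⟩
    · exact ⟨x, fun h => absurd h hπ⟩
  choose s hs using hex'
  set A := univ.filter (fun a => (T.pos a).2 = c) with hA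
  have hmA : ∀ a, a ∈ A ↔ (T.pos a).2 = c := fun a => by simp [hA]
  have e1 : ∀ a, polytabloid R (T.perm (Equiv.swap a x)) = ∑ π ∈ colStab T,
      ((Equiv.Perm.sign π : ℤ) : R) •
        Finsupp.single (permTabloid μ.parts (Equiv.swap a x) (rowTabloid T π)) (1 : R) := by
    intro a
    rw [← permM_poly]
    unfold polytabloid
    rw [map_sum]
    apply sum_congr rfl
    intro π _
    rw [map_smul, permM_single]
  simp only [e1]
  rw [sum_comm]
  have e2 : ∀ π ∈ colStab T, permTabloid μ.parts (Equiv.swap (s π) x) (rowTabloid T π)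
      = rowTabloid T π := by
    intro π hπ
    apply Subtype.ext
    funext k
    simp only [permTabloid, rowTabloid, Equiv.symm_swap]
    obtain ⟨h1, h2⟩ := hs π hπ
    rw [Equiv.swap_apply_def]
    split_ifs with h3 h4
    · rw [h3, h2]
    · rw [h4, h2]
    · rfl
  have e3 : ∀ π ∈ colStab T, ∑ a ∈ A, ((Equiv.Perm.sign π : ℤ) : R) •
        Finsupp.single (permTabloid μ.parts (Equiv.swap a x) (rowTabloid T π)) (1 : R)
      = ((Equiv.Perm.sign π : ℤ) : R) • Finsupp.single (rowTabloid T π) (1 : R)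
        + ∑ a ∈ A.erase (s π), ((Equiv.Perm.sign π : ℤ) : R) •
        Finsupp.single (permTabloid μ.parts (Equiv.swap a x) (rowTabloid T π)) (1 : R) := by
    intro π hπ
    rw [← add_sum_erase A _ ((hmA _).mpr (hs π hπ).1), e2 π hπ]
  rw [sum_congr rfl e3, sum_add_distrib]
  symm
  rw [show polytabloid R T = _ + 0 from (add_zero _).symm]
  congr 1
  rw [sum_sigma']
  have key : ∀ π ∈ colStab T, ∀ a ∈ A.erase (s π),
      π * Equiv.swap a (s π) ∈ colStab T ∧ s (π * Equiv.swap a (s π)) = a := by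
    intro π hπ a ha
    rw [mem_erase, hmA] at ha
    have h1 := hs π hπ
    have hmem : π * Equiv.swap a (s π) ∈ colStab T :=
      colStab_mul hπ (colStab_swap (ha.2.trans h1.1.symm))
    refine ⟨hmem, ?_⟩
    have h2 := hs _ hmem
    apply (π * Equiv.swap a (s π)).injective
    apply T.inj
    rw [h2.2, Equiv.Perm.mul_apply, Equiv.Perm.mul_apply, Equiv.swap_apply_left, h1.2]
    rw [Equiv.swap_apply_of_ne_of_ne]
    · rintro rfl
      omega
    · intro e
      rw [e] at hcx
      omega
  apply sum_involution (fun y _ => (⟨y.1 * Equiv.swap y.2 (s y.1), s y.1⟩ :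
    Σ _ : Equiv.Perm (Fin N), Fin N))
  · rintro ⟨π, a⟩ hy
    rw [mem_sigma] at hy
    obtain ⟨hπ, ha⟩ := hy
    simp only at hπ ha ⊢
    have hne : a ≠ s π := (mem_erase.mp ha).1
    have hac : (T.pos a).2 = c := (hmA a).mp (mem_erase.mp ha).2
    have h1 := hs π hπ
    have : permTabloid μ.parts (Equiv.swap (s π) x) (rowTabloid T (π * Equiv.swap a (s π)))
        = permTabloid μ.parts (Equiv.swap a x) (rowTabloid T π) := by
      apply Subtype.ext
      funext k
      have hax : a ≠ x := by rintro rfl; omega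
      have hsx : s π ≠ x := by intro e; rw [← e] at hcx; omega
      simp only [permTabloid, rowTabloid, Equiv.symm_swap, Equiv.Perm.mul_apply]
      by_cases k1 : k = a
      · subst k1
        rw [Equiv.swap_apply_of_ne_of_ne hne hax, Equiv.swap_apply_left, Equiv.swap_apply_left,
          h1.2]
      by_cases k2 : k = x
      · subst k2
        rw [Equiv.swap_apply_right, Equiv.swap_apply_right, Equiv.swap_apply_right]
      by_cases k3 : k = s π
      · rw [k3, Equiv.swap_apply_left, Equiv.swap_apply_of_ne_of_ne (Ne.symm hax) (Ne.symm hsx),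
          Equiv.swap_apply_of_ne_of_ne (Ne.symm hne) hsx, h1.2]
      · rw [Equiv.swap_apply_of_ne_of_ne k3 k2, Equiv.swap_apply_of_ne_of_ne k1 k3,
          Equiv.swap_apply_of_ne_of_ne k1 k2]
    rw [this, map_mul, Equiv.Perm.sign_swap hne]
    simp
  · rintro ⟨π, a⟩ hy _ e
    rw [mem_sigma] at hy
    have hne : a ≠ s π := (mem_erase.mp hy.2).1
    simp only [Sigma.mk.injEq] at e
    exact hne (eq_of_heq e.2).symm
  · rintro ⟨π, a⟩ hy
    rw [mem_sigma] at hy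
    obtain ⟨hπ, ha⟩ := hy
    obtain ⟨k1, k2⟩ := key π hπ a ha
    rw [mem_sigma]
    refine ⟨k1, ?_⟩
    show s π ∈ A.erase (s (π * Equiv.swap a (s π)))
    rw [k2, mem_erase, hmA]
    exact ⟨Ne.symm (mem_erase.mp ha).1, (hs π hπ).1⟩
  · rintro ⟨π, a⟩ hy
    rw [mem_sigma] at hy
    obtain ⟨hπ, ha⟩ := hy
    obtain ⟨k1, k2⟩ := key π hπ a ha
    simp only at k1 k2 ⊢
    rw [k2, Equiv.swap_comm (s π) a, mul_assoc, Equiv.swap_mul_self, mul_one]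

/-- Evaluate at a function, extended by zero. -/
noncomputable def ev (c : ℕ → ℕ) (g : Fin N → ℕ) : PermMod R N c →ₗ[R] R :=
  open Classical in
  if h : ∀ i, (univ.filter fun k => g k = i).card = c i then Finsupp.lapply ⟨g, h⟩ else 0

lemma ev_tab {c : ℕ → ℕ} (τ : Tabloid N c) (v : PermMod R N c) : ev c τ.1 v = v τ := by
  unfold ev
  rw [dif_pos τ.2]
  rfl

lemma ev_ne {c : ℕ → ℕ} {g : Fin N → ℕ} {v : PermMod R N c} (h : ev c g v ≠ 0) :
    ∀ i, (univ.filter fun k => g k = i).card = c i := by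
  by_contra hn
  unfold ev at h
  rw [dif_neg hn] at h
  exact h rfl

lemma ev_single {c : ℕ → ℕ} (g : Fin N → ℕ) (τ : Tabloid N c) (r : R) :
    ev c g (Finsupp.single τ r) = if τ.1 = g then r else 0 := by
  by_cases h : ∀ i, (univ.filter fun k => g k = i).card = c i
  · have := ev_tab (R := R) (⟨g, h⟩ : Tabloid N c) (Finsupp.single τ r)
    simp only at this
    rw [this]
    by_cases e : τ.1 = g
    · rw [if_pos e]
      have e' : τ = (⟨g, h⟩ : Tabloid N c) := Subtype.ext e
      rw [← e']
      exact Finsupp.single_eq_same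
    · rw [if_neg e]
      exact Finsupp.single_eq_of_ne (fun e' => e (congrArg Subtype.val e'.symm))
  · unfold ev
    rw [dif_neg h, if_neg]
    · rfl
    · intro e
      apply h
      rw [← e]
      exact τ.2

lemma ev_perm {c : ℕ → ℕ} (σ : Equiv.Perm (Fin N)) (g : Fin N → ℕ) (v : PermMod R N c) :
    ev c g (permM R c σ v) = ev c (g ∘ σ) v := by
  induction v using Finsupp.induction_linear with
  | zero => simp
  | add u v hu hv => rw [map_add, map_add, map_add, hu, hv]
  | single τ r =>
    rw [permM_single, ev_single, ev_single]
    have : (permTabloid c σ τ).1 = g ↔ τ.1 = g ∘ σ := by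
      constructor
      · rintro rfl
        funext k
        simp [permTabloid]
      · intro e
        funext k
        simp [permTabloid, e]
    simp only [this]

lemma ev_poly (T : Placement μ) (g : Fin N → ℕ) : ev μ.parts g (polytabloid R T)
    = ∑ π ∈ colStab T, if (fun k => (T.pos (π k)).1) = g then ((Equiv.Perm.sign π : ℤ) : R) else 0 := by
  unfold polytabloid
  rw [map_sum]
  apply sum_congr rfl
  intro π _
  rw [map_smul, ev_single, smul_eq_mul, mul_ite, mul_one, mul_zero]
  rfl

lemma raise_poly (T : Placement μ) (g : Fin N → ℕ) {i j : ℕ} (hi : 1 ≤ i) (hij : i < j) :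
    ∑ y ∈ univ.filter (fun y => g y = i), ev μ.parts (Function.update g y j) (polytabloid R T)
      = 0 := by
  classical
  simp only [ev_poly]
  rw [sum_sigma', ← sum_filter]
  have hex : ∀ x : (Σ _ : Fin N, Equiv.Perm (Fin N)), ∃ z, x.2 ∈ colStab T →
      (T.pos (x.2 x.1)).1 = j → T.pos (x.2 z) = (i, (T.pos x.1).2) := by
    intro x
    by_cases h : x.2 ∈ colStab T ∧ (T.pos (x.2 x.1)).1 = j
    · obtain ⟨k, hk⟩ := T.surj (i, (T.pos x.1).2) (by
        have hm := T.mem (x.2 x.1)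
        rw [← mem_colStab.mp h.1 x.1]
        refine ⟨hi, hm.2.1, hm.2.2.trans ?_⟩
        rw [h.2]
        exact μ.antitone hi hij.le)
      refine ⟨x.2.symm k, fun _ _ => ?_⟩
      rw [Equiv.apply_symm_apply, hk]
    · exact ⟨x.1, fun h1 h2 => absurd ⟨h1, h2⟩ h⟩
  choose s hs using hex
  -- facts about members
  have fact : ∀ x : (Σ _ : Fin N, Equiv.Perm (Fin N)), x.2 ∈ colStab T →
      (fun k => (T.pos (x.2 k)).1) = Function.update g x.1 j → 
      T.pos (x.2 (s x)) = (i, (T.pos x.1).2) ∧ s x ≠ x.1 ∧ (T.pos (x.2 x.1)).1 = j ∧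
        (T.pos (s x)).2 = (T.pos x.1).2 := by
    intro x hx hg
    have h1 : (T.pos (x.2 x.1)).1 = j := by
      have := congrFun hg x.1
      simpa using this
    have h2 := hs x hx h1
    refine ⟨h2, ?_, h1, ?_⟩
    · intro e
      rw [e] at h2
      rw [h2] at h1
      simp only at h1
      omega
    · rw [← mem_colStab.mp hx, h2]
  have key : ∀ x : (Σ _ : Fin N, Equiv.Perm (Fin N)), g x.1 = i → x.2 ∈ colStab T →
      (fun k => (T.pos (x.2 k)).1) = Function.update g x.1 j →
      g (s x) = i ∧ x.2 * Equiv.swap x.1 (s x) ∈ colStab T ∧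
      (fun k => (T.pos ((x.2 * Equiv.swap x.1 (s x)) k)).1) = Function.update g (s x) j ∧
      s ⟨s x, x.2 * Equiv.swap x.1 (s x)⟩ = x.1 := by
    intro x hx0 hx hg
    obtain ⟨f1, f2, f3, f4⟩ := fact x hx hg
    have g1 : g (s x) = i := by
      have := congrFun hg (s x)
      rw [Function.update_of_ne f2, f1] at this
      exact this.symm
    have g2 : x.2 * Equiv.swap x.1 (s x) ∈ colStab T := colStab_mul hx (colStab_swap f4.symm)
    have g3 : (fun k => (T.pos ((x.2 * Equiv.swap x.1 (s x)) k)).1) = Function.update g (s x) j := by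
      funext k
      rw [Equiv.Perm.mul_apply]
      by_cases k1 : k = s x
      · rw [k1, Equiv.swap_apply_right, Function.update_self, f3]
      · rw [Function.update_of_ne k1]
        by_cases k2 : k = x.1
        · rw [k2, Equiv.swap_apply_left, f1, hx0]
        · rw [Equiv.swap_apply_of_ne_of_ne k2 k1]
          have := congrFun hg k
          rwa [Function.update_of_ne k2] at this
    refine ⟨g1, g2, g3, ?_⟩
    obtain ⟨d1, d2, d3, d4⟩ := fact ⟨s x, x.2 * Equiv.swap x.1 (s x)⟩ g2 g3
    apply (x.2 * Equiv.swap x.1 (s x)).injective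
    apply T.inj
    rw [d1, Equiv.Perm.mul_apply, Equiv.swap_apply_left, f1]
    simp only [f4]
  apply sum_involution (fun x _ => (⟨s x, x.2 * Equiv.swap x.1 (s x)⟩ :
    Σ _ : Fin N, Equiv.Perm (Fin N)))
  · intro x hx
    rw [mem_filter, mem_sigma, mem_filter] at hx
    obtain ⟨f1, f2, f3, f4⟩ := fact x hx.1.2 hx.2
    simp only
    rw [map_mul, Equiv.Perm.sign_swap (Ne.symm f2)]
    simp
  · intro x hx _ e
    rw [mem_filter, mem_sigma, mem_filter] at hx
    obtain ⟨f1, f2, f3, f4⟩ := fact x hx.1.2 hx.2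
    exact f2 (congrArg Sigma.fst e)
  · intro x hx
    rw [mem_filter, mem_sigma, mem_filter] at hx ⊢
    obtain ⟨k1, k2, k3, k4⟩ := key x hx.1.1.2 hx.1.2 hx.2
    exact ⟨⟨⟨mem_univ _, k1⟩, k2⟩, k3⟩
  · intro x hx
    rw [mem_filter, mem_sigma, mem_filter] at hx
    obtain ⟨k1, k2, k3, k4⟩ := key x hx.1.1.2 hx.1.2 hx.2
    simp only [k4]
    rw [Equiv.swap_comm (s x) x.1, mul_assoc, Equiv.swap_mul_self, mul_one]

lemma raise_specht {v : PermMod R N μ.parts} (hv : v ∈ Specht R μ) (g : Fin N → ℕ) {i j : ℕ}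
    (hi : 1 ≤ i) (hij : i < j) :
    ∑ y ∈ univ.filter (fun y => g y = i), ev μ.parts (Function.update g y j) v = 0 := by
  unfold Specht at hv
  induction hv using Submodule.span_induction with
  | mem x hx =>
    obtain ⟨T, rfl⟩ := hx
    exact raise_poly T g hi hij
  | zero => simp
  | add x y _ _ hx hy => simp only [map_add, sum_add_distrib, hx, hy, add_zero]
  | smul a x _ hx => simp only [map_smul, ← smul_sum, hx, smul_zero]

/-- Exchanging two columns of equal length. -/
lemma poly_colswap (T : Placement μ) {c c' : ℕ} (hc : 1 ≤ c) (hc' : 1 ≤ c')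
    (h : ∀ i, 1 ≤ i → (c ≤ μ.parts i ↔ c' ≤ μ.parts i)) :
    ∃ T' : Placement μ, polytabloid R T' = polytabloid R T ∧
      ∀ k, T'.pos k = ((T.pos k).1, Equiv.swap c c' (T.pos k).2) := by
  have hcell : ∀ x : ℕ × ℕ, x ∈ μ.cells → (x.1, Equiv.swap c c' x.2) ∈ μ.cells := by
    intro x hx
    obtain ⟨h1, h2, h3⟩ := hx
    refine ⟨h1, ?_, ?_⟩
    · show 0 < Equiv.swap c c' x.2
      rw [Equiv.swap_apply_def]
      split_ifs <;> omega
    · show Equiv.swap c c' x.2 ≤ μ.parts x.1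
      have := h x.1 h1
      rw [Equiv.swap_apply_def]
      split_ifs with e1 e2
      · rw [← this, ← e1]; exact h3
      · rw [this, ← e2]; exact h3
      · exact h3
  let T' : Placement μ :=
    { pos := fun k => ((T.pos k).1, Equiv.swap c c' (T.pos k).2)
      mem := fun k => hcell _ (T.mem k)
      inj := by
        intro a b e
        simp only [Prod.mk.injEq, EmbeddingLike.apply_eq_iff_eq] at e
        exact T.inj (Prod.ext e.1 e.2)
      surj := by
        intro x hx
        obtain ⟨k, hk⟩ := T.surj _ (hcell x hx)
        refine ⟨k, ?_⟩
        simp [hk] }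
  refine ⟨T', ?_, fun k => rfl⟩
  have hcs : colStab T' = colStab T := by
    ext π
    rw [mem_colStab, mem_colStab]
    simp [T']
  unfold polytabloid
  rw [hcs]
  rfl

end SpechtFacts

section Shape
variable {N : ℕ} (μ : Partition N)

lemma Partition.sum_le (i : ℕ) : ∑ j ∈ Icc 1 i, μ.parts j ≤ N := by
  have h1 := finsum_eq_sum_of_support_subset μ.parts
    (s := μ.finite_support.toFinset ∪ Icc 1 i) (by intro x hx; simp; left; simpa using hx)
  rw [μ.sum_parts] at h1
  calc _ ≤ _ := sum_le_sum_of_subset (subset_union_right (s₁ := μ.finite_support.toFinset))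
    _ = N := h1.symm

lemma Partition.row_le {i : ℕ} (hi : 1 ≤ μ.parts i) : i ≤ N := by
  have h1 := μ.sum_le i
  have h2 : ∑ j ∈ Icc 1 i, 1 ≤ ∑ j ∈ Icc 1 i, μ.parts j := by
    apply sum_le_sum
    intro j hj
    rw [mem_Icc] at hj
    exact hi.trans (μ.antitone hj.1 hj.2)
  simp at h2
  omega

lemma Partition.parts_le (i : ℕ) : μ.parts i ≤ N := by
  rcases Nat.eq_zero_or_pos i with rfl | hi
  · rw [μ.parts_zero]; omega
  · refine le_trans ?_ (μ.sum_le i)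
    exact single_le_sum (f := μ.parts) (fun _ _ => Nat.zero_le _) (mem_Icc.mpr ⟨hi, le_rfl⟩)

lemma Partition.sum_eq : ∑ j ∈ Icc 1 N, μ.parts j = N := by
  rw [← finsum_eq_sum_of_support_subset μ.parts, μ.sum_parts]
  intro x hx
  rw [Function.mem_support] at hx
  rw [coe_Icc, Set.mem_Icc]
  refine ⟨?_, μ.row_le (by omega)⟩
  by_contra h0
  rw [show x = 0 by omega, μ.parts_zero] at hx
  exact hx rfl

/-- Column lengths. -/
def Partition.ht (c : ℕ) : ℕ := ((Icc 1 N).filter fun i => c ≤ μ.parts i).card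

lemma Partition.le_ht {i c : ℕ} (hi : 1 ≤ i) (hc : 1 ≤ c) : i ≤ μ.ht c ↔ c ≤ μ.parts i := by
  unfold Partition.ht
  constructor
  · intro h
    by_contra hn
    have : (Icc 1 N).filter (fun i => c ≤ μ.parts i) ⊆ Icc 1 (i - 1) := by
      intro j hj
      rw [mem_filter, mem_Icc] at hj
      rw [mem_Icc]
      refine ⟨hj.1.1, ?_⟩
      by_contra hlt
      have := μ.antitone hi (show i ≤ j by omega)
      omega
    have := card_le_card this
    rw [Nat.card_Icc] at this
    omega
  · intro h
    have hN := μ.row_le (hc.trans h)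
    have : Icc 1 i ⊆ (Icc 1 N).filter (fun i => c ≤ μ.parts i) := by
      intro j hj
      rw [mem_Icc] at hj
      rw [mem_filter, mem_Icc]
      exact ⟨by omega, h.trans (μ.antitone hj.1 hj.2)⟩
    have := card_le_card this
    rw [Nat.card_Icc] at this
    omega

lemma Partition.ht_anti : Antitone μ.ht := by
  intro c c' h
  apply card_le_card
  intro i hi
  rw [mem_filter] at hi ⊢
  exact ⟨hi.1, h.trans hi.2⟩

lemma Partition.ht_zero : μ.ht (N + 1) = 0 := by
  unfold Partition.ht
  rw [card_eq_zero, filter_eq_empty_iff]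
  intro i _
  have := μ.parts_le i
  omega

variable {μ}

lemma mem_cells {x : ℕ × ℕ} : x ∈ μ.cells ↔ x ∈ Reg μ.ht (N + 1) 1 := by
  rw [mem_Reg]
  constructor
  · rintro ⟨h1, h2, h3⟩
    have := μ.parts_le x.1
    exact ⟨⟨h2, by omega⟩, h1, (μ.le_ht h1 h2).mpr h3⟩
  · rintro ⟨⟨h1, h2⟩, h3, h4⟩
    exact ⟨h3, h1, (μ.le_ht h3 h1).mp h4⟩

lemma mem_remRows {b : ℕ} : b ∈ remRows μ ↔ 1 ≤ b ∧ μ.parts (b + 1) < μ.parts b := by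
  unfold remRows
  rw [mem_filter, mem_Icc]
  constructor
  · rintro ⟨h1, h2⟩; exact ⟨h1.1, h2⟩
  · rintro ⟨h1, h2⟩; exact ⟨⟨h1, μ.row_le (by omega)⟩, h2⟩

lemma remRows_of_ht {b c : ℕ} (hb : 1 ≤ b) (hc : 1 ≤ c) (h : μ.ht c = b) : b ∈ remRows μ := by
  rw [mem_remRows]
  refine ⟨hb, ?_⟩
  have h1 := (μ.le_ht hb hc).mp h.ge
  have h2 := (μ.le_ht (show 1 ≤ b + 1 by omega) hc).not.mp (by omega)
  omega

variable (μ) in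
lemma exists_placement : Nonempty (Placement μ) := by
  classical
  let S : Finset (Σ _ : ℕ, ℕ) := (Icc 1 N).sigma fun i => Icc 1 (μ.parts i)
  have hS : S.card = N := by
    rw [card_sigma]
    simp only [Nat.card_Icc, Nat.add_sub_cancel]
    exact μ.sum_eq
  let e : Fin N ≃ S := (S.equivFinOfCardEq hS).symm
  have hm : ∀ x : (Σ _ : ℕ, ℕ), x ∈ S ↔ (x.1, x.2) ∈ μ.cells := by
    intro x
    show x ∈ (Icc 1 N).sigma _ ↔ _
    rw [mem_sigma, mem_Icc, mem_Icc]
    constructor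
    · rintro ⟨h1, h2⟩
      exact ⟨h1.1, h2.1, h2.2⟩
    · rintro ⟨h1, h2, h3⟩
      exact ⟨⟨h1, μ.row_le (le_trans h2 h3)⟩, h2, h3⟩
  refine ⟨⟨fun k => ((e k).1.1, (e k).1.2), fun k => (hm _).mp (e k).2, ?_, ?_⟩⟩
  · intro a b h
    simp only [Prod.mk.injEq] at h
    apply e.injective
    apply Subtype.ext
    exact Sigma.ext h.1 (heq_of_eq h.2)
  · intro c hc
    refine ⟨e.symm ⟨⟨c.1, c.2⟩, (hm _).mpr hc⟩, ?_⟩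
    simp

lemma Placement.ext' {T T' : Placement μ} (h : ∀ k, T.pos k = T'.pos k) : T = T' := by
  cases T; cases T'
  congr
  funext k
  exact h k

lemma exists_perm (T T' : Placement μ) : ∃ σ : Equiv.Perm (Fin N), T' = T.perm σ := by
  have : ∀ k, ∃ j, T.pos j = T'.pos k := fun k => T.surj _ (T'.mem k)
  choose s hs using this
  have si : Function.Injective s := by
    intro a b e
    apply T'.inj
    rw [← hs, ← hs, e]
  let e : Equiv.Perm (Fin N) := Equiv.ofBijective s (Finite.injective_iff_bijective.mp si)
  refine ⟨e.symm, Placement.ext' fun k => ?_⟩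
  show T'.pos k = T.pos (s k)
  rw [hs]

lemma perm_swap_pos (T : Placement μ) (a b k : Fin N) :
    (T.perm (Equiv.swap a b)).pos k = Equiv.swap (T.pos a) (T.pos b) (T.pos k) := by
  show T.pos (Equiv.swap a b k) = _
  rw [T.inj.swap_apply]

lemma cnt_cells (T : Placement μ) (f : ℕ × ℕ → ℕ) (i : ℕ) :
    cnt (Reg μ.ht (N + 1) 1) f i = (univ.filter fun k => f (T.pos k) = i).card := by
  symm
  unfold cnt
  apply card_bij (fun k _ => T.pos k)
  · intro k hk
    rw [mem_filter] at hk ⊢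
    exact ⟨mem_cells.mp (T.mem k), hk.2⟩
  · intro a _ b _ e
    exact T.inj e
  · intro x hx
    rw [mem_filter] at hx
    obtain ⟨k, rfl⟩ := T.surj x (mem_cells.mpr hx.1)
    exact ⟨k, by simpa using hx.2, rfl⟩

lemma cnt_cells_fst (i : ℕ) : cnt (Reg μ.ht (N + 1) 1) Prod.fst i = μ.parts i := by
  obtain ⟨T⟩ := exists_placement μ
  rw [cnt_cells T]
  exact rowFiber_card T i

end Shape

section Bound
variable {F : Type*} [Field F] {n : ℕ} {lam : Partition (n + 1)}

/-- A polytabloid as an element of the Specht module. -/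
noncomputable def pe (F : Type*) [Field F] {N : ℕ} {μ : Partition N} (T : Placement μ) :
    ↥(Specht F μ) := ⟨polytabloid F T, Submodule.subset_span ⟨T, rfl⟩⟩

/-- `f` has a zero exactly at the place of the last symbol. -/
def Compat (T : Placement lam) (f : ℕ × ℕ → ℕ) : Prop := ∀ k, f (T.pos k) = 0 ↔ k = Fin.last n

open Classical in
/-- The function of fillings attached to an endomorphism. -/
noncomputable def vb (b : ℕ) (f : ℕ × ℕ → ℕ) :
    Module.End F ↥(Specht F lam) →ₗ[F] F :=
  if h : ∃ T : Placement lam, Compat T f then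
    (ev lam.parts (Function.update (f ∘ h.choose.pos) (Fin.last n) b)).comp
      ((Specht F lam).subtype.comp (LinearMap.applyₗ (pe F h.choose)))
  else 0

lemma vb_eq {Φ : Module.End F ↥(Specht F lam)} (hΦ : Φ ∈ EndRes F lam) {b : ℕ} {f : ℕ × ℕ → ℕ}
    {T : Placement lam} (hT : Compat T f) :
    vb b f Φ = ev lam.parts (Function.update (f ∘ T.pos) (Fin.last n) b) (Φ (pe F T)).1 := by
  have h : ∃ T : Placement lam, Compat T f := ⟨T, hT⟩
  unfold vb
  rw [dif_pos h]
  obtain ⟨σ, hσ⟩ := exists_perm T h.choose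
  have h1 := h.choose_spec
  generalize h.choose = T' at *
  have hl : σ.symm (Fin.last n) = Fin.last n := by
    rw [← hT]
    have : T.pos (σ.symm (Fin.last n)) = T'.pos (Fin.last n) := by rw [hσ]; rfl
    rw [this]
    exact (h1 _).mpr rfl
  have hl' : σ (Fin.last n) = Fin.last n := by
    conv_lhs => rw [← hl]
    simp
  have := hΦ σ hl' (pe F T') (pe F T) (by
    show polytabloid F T' = permM F lam.parts σ (polytabloid F T)
    rw [permM_poly, hσ])
  show ev lam.parts _ (Φ (pe F T')).1 = _
  rw [this, ev_perm]
  congr 2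
  funext k
  rw [Function.comp]
  by_cases hk : k = Fin.last n
  · rw [hk, hl', Function.update_self, Function.update_self]
  · have hk' : σ k ≠ Fin.last n := by
      intro e
      apply hk
      apply σ.injective
      rw [e, hl']
    rw [Function.update_of_ne hk', Function.update_of_ne hk, hσ]
    simp [Placement.perm]

lemma vb_none {Φ : Module.End F ↥(Specht F lam)} {b : ℕ} {f : ℕ × ℕ → ℕ}
    (h : ¬ ∃ T : Placement lam, Compat T f) : vb b f Φ = 0 := by
  unfold vb
  rw [dif_neg h]
  rfl

lemma compat_swap {T : Placement lam} {f : ℕ × ℕ → ℕ} (hT : Compat T f) (a c : Fin (n + 1)) :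
    Compat (T.perm (Equiv.swap a c)) (f ∘ Equiv.swap (T.pos a) (T.pos c)) := by
  intro k
  rw [Function.comp, perm_swap_pos, Equiv.swap_apply_self, hT]

lemma vb_swap {Φ : Module.End F ↥(Specht F lam)} (hΦ : Φ ∈ EndRes F lam) {b : ℕ} {f : ℕ × ℕ → ℕ}
    {T : Placement lam} (hT : Compat T f) (a c : Fin (n + 1)) :
    vb b (f ∘ Equiv.swap (T.pos a) (T.pos c)) Φ
      = ev lam.parts (Function.update (f ∘ T.pos) (Fin.last n) b)
        (Φ (pe F (T.perm (Equiv.swap a c)))).1 := by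
  rw [vb_eq hΦ (compat_swap hT a c)]
  congr 3
  funext k
  simp only [Function.comp]
  rw [perm_swap_pos, Equiv.swap_apply_self]

lemma compat_of_swap {f : ℕ × ℕ → ℕ} {x y : ℕ × ℕ} (hx : x ∈ lam.cells) (hy : y ∈ lam.cells)
    (h : ∃ T : Placement lam, Compat T (f ∘ Equiv.swap x y)) : ∃ T : Placement lam, Compat T f := by
  obtain ⟨T, hT⟩ := h
  obtain ⟨a, rfl⟩ := T.surj x hx
  obtain ⟨c, rfl⟩ := T.surj y hy
  refine ⟨T.perm (Equiv.swap a c), ?_⟩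
  intro k
  rw [← hT, perm_swap_pos]
  rfl

lemma card_update (g : Fin (n + 1) → ℕ) (x : Fin (n + 1)) (b i : ℕ) (hx : g x = 0) :
    (univ.filter fun k => g k = i).card + (if i = b then 1 else 0)
      = (univ.filter fun k => Function.update g x b k = i).card + (if i = 0 then 1 else 0) := by
  classical
  simp only [card_filter]
  rw [← add_sum_erase univ _ (mem_univ x), ← add_sum_erase univ (fun k => if Function.update g x b k = i then 1 else 0) (mem_univ x)]
  have : ∑ k ∈ univ.erase x, (if g k = i then 1 else 0)
      = ∑ k ∈ univ.erase x, (if Function.update g x b k = i then 1 else 0) := by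
    apply sum_congr rfl
    intro k hk
    rw [Function.update_of_ne (mem_erase.mp hk).1]
  rw [this, hx, Function.update_self]
  simp only [eq_comm (a := (0 : ℕ)), eq_comm (a := b)]
  omega

lemma vb_good {Φ : Module.End F ↥(Specht F lam)} (hΦ : Φ ∈ EndRes F lam) {b : ℕ}
    (hb : ∀ (T : Placement lam) (τ : Tabloid (n + 1) lam.parts), b < τ.1 (Fin.last n) →
      (Φ (pe F T)).1 τ = 0) :
    Good lam.ht (n + 1 + 1) 1 b (fun f => vb (lam := lam) b f Φ) where
  congr f g hfg := by
    have hc : ∀ T : Placement lam, Compat T f ↔ Compat T g := by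
      intro T
      unfold Compat
      simp only [fun k => hfg _ (mem_cells.mp (T.mem k))]
    by_cases h : ∃ T : Placement lam, Compat T f
    · obtain ⟨T, hT⟩ := h
      show vb b f Φ = vb b g Φ
      rw [vb_eq hΦ hT, vb_eq hΦ ((hc T).mp hT)]
      congr 3
      funext k
      exact hfg _ (mem_cells.mp (T.mem k))
    · show vb b f Φ = vb b g Φ
      rw [vb_none h, vb_none (fun ⟨T, hT⟩ => h ⟨T, (hc T).mpr hT⟩)]
  alt f c x y hc hM hx hy hxy := by
    have hx' := mem_cells.mpr (Col_subset_Reg hc hM hx)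
    have hy' := mem_cells.mpr (Col_subset_Reg hc hM hy)
    show vb b _ Φ = - vb b f Φ
    by_cases h : ∃ T : Placement lam, Compat T f
    · obtain ⟨T, hT⟩ := h
      obtain ⟨a, rfl⟩ := T.surj x hx'
      obtain ⟨d, rfl⟩ := T.surj y hy'
      rw [vb_swap hΦ hT, vb_eq hΦ hT]
      have : pe F (T.perm (Equiv.swap a d)) = (-1 : F) • pe F T := by
        apply Subtype.ext
        show polytabloid F (T.perm (Equiv.swap a d)) = (-1 : F) • polytabloid F T
        rw [neg_one_smul]
        exact poly_swap T (fun e => hxy (by rw [e])) ((mem_Col.mp hx).2.trans (mem_Col.mp hy).2.symm)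
      rw [this, map_smul, Submodule.coe_smul, map_smul, neg_one_smul]
    · rw [vb_none h, vb_none (fun h' => h (compat_of_swap hx' hy' h')), neg_zero]
  cont f hf i := by
    by_cases h : ∃ T : Placement lam, Compat T f
    · obtain ⟨T, hT⟩ := h
      change vb b f Φ ≠ 0 at hf
      rw [vb_eq hΦ hT] at hf
      have h1 := ev_ne hf i
      rw [cnt_cells T, cnt_cells_fst, ← h1]
      exact card_update (f ∘ T.pos) (Fin.last n) b i ((hT _).mpr rfl)
    · exact absurd (vb_none h) hf
  gar f c c' x hc hcc hM hx := by
    have hx' := mem_cells.mpr (Col_subset_Reg (show 1 ≤ c' by omega) hM hx)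
    have hCol : ∀ a ∈ Col lam.ht c, a ∈ lam.cells := fun a ha =>
      mem_cells.mpr (Col_subset_Reg hc (by omega) ha)
    show vb b f Φ = ∑ a ∈ Col lam.ht c, vb b (f ∘ Equiv.swap a x) Φ
    by_cases h : ∃ T : Placement lam, Compat T f
    · obtain ⟨T, hT⟩ := h
      obtain ⟨y, rfl⟩ := T.surj x hx'
      rw [vb_eq hΦ hT]
      have hg : pe F T = ∑ a ∈ univ.filter (fun a => (T.pos a).2 = c),
          pe F (T.perm (Equiv.swap a y)) := by
        apply Subtype.ext
        rw [AddSubmonoidClass.coe_finsetSum]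
        exact garnir T y c hc (by rw [(mem_Col.mp hx).2]; exact hcc)
      conv_lhs => rw [hg]
      rw [map_sum, AddSubmonoidClass.coe_finsetSum, map_sum]
      apply sum_bij (fun a _ => T.pos a)
      · intro a ha
        have := mem_Reg.mp (mem_cells.mp (T.mem a))
        rw [mem_filter] at ha
        rw [mem_Col]
        rw [ha.2] at this
        exact ⟨this.2, ha.2⟩
      · intro a _ d _ e
        exact T.inj e
      · intro a ha
        obtain ⟨d, rfl⟩ := T.surj a (hCol a ha)
        exact ⟨d, by rw [mem_filter]; exact ⟨mem_univ _, (mem_Col.mp ha).2⟩, rfl⟩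
      · intro a ha
        rw [vb_swap hΦ hT]
    · rw [vb_none h, sum_eq_zero]
      intro a ha
      exact vb_none (fun h' => h (compat_of_swap (hCol a ha) hx' h'))
  rais f i j hi hij := by
    have hco : ∀ x, f x = i → ∀ T : Placement lam, (Compat T (Function.update f x j) ↔ Compat T f) := by
      intro x hx T
      unfold Compat
      apply forall_congr'
      intro k
      by_cases e : T.pos k = x
      · rw [e, Function.update_self, hx]
        have : j ≠ 0 := by omega
        have : i ≠ 0 := by omega
        simp [*]
      · rw [Function.update_of_ne e]
    show ∑ x ∈ _, vb b _ Φ = 0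
    by_cases h : ∃ T : Placement lam, Compat T f
    · obtain ⟨T, hT⟩ := h
      have h1 := raise_specht (Φ (pe F T)).2 (Function.update (f ∘ T.pos) (Fin.last n) b) hi hij
      rw [← h1]
      have hl : f (T.pos (Fin.last n)) = 0 := (hT _).mpr rfl
      have hsub : (univ.filter fun k => f (T.pos k) = i) ⊆
          univ.filter fun k => Function.update (f ∘ T.pos) (Fin.last n) b k = i := by
        intro k hk
        rw [mem_filter] at hk ⊢
        refine ⟨mem_univ _, ?_⟩
        rw [Function.update_of_ne]
        · exact hk.2
        · rintro rfl
          omega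
      rw [← sum_subset hsub]
      · symm
        apply sum_bij (fun k _ => T.pos k)
        · intro k hk
          rw [mem_filter] at hk ⊢
          exact ⟨mem_cells.mp (T.mem k), hk.2⟩
        · intro a _ b _ e
          exact T.inj e
        · intro x hx
          rw [mem_filter] at hx
          obtain ⟨k, rfl⟩ := T.surj x (mem_cells.mpr hx.1)
          exact ⟨k, by rw [mem_filter]; exact ⟨mem_univ _, hx.2⟩, rfl⟩
        · intro k hk
          rw [mem_filter] at hk
          rw [vb_eq hΦ ((hco _ hk.2 T).mpr hT)]
          congr 2
          have hkl : k ≠ Fin.last n := by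
            rintro rfl
            omega
          rw [Function.update_comm hkl.symm]
          congr 1
          funext z
          by_cases e : z = k
          · rw [e, Function.update_self, Function.comp, Function.update_self]
          · rw [Function.update_of_ne e, Function.comp, Function.comp,
              Function.update_of_ne (fun e' => e (T.inj e'))]
      · intro k hk hk'
        rw [mem_filter] at hk hk'
        have hkl : k = Fin.last n := by
          by_contra hne
          apply hk'
          rw [Function.update_of_ne hne] at hk
          exact hk
        subst hkl
        rw [Function.update_idem]
        rw [Function.update_self] at hk
        by_contra hne
        have hcon := ev_ne hne
        have := ev_tab (⟨_, hcon⟩ : Tabloid (n + 1) lam.parts) (Φ (pe F T)).1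
        simp only at this
        rw [this] at hne
        apply hne
        apply hb
        simp only [Function.update_self]
        omega
    · apply sum_eq_zero
      intro x hx
      rw [mem_filter] at hx
      exact vb_none (fun ⟨T, hT⟩ => h ⟨T, (hco x hx.2 T).mp hT⟩)

theorem end_bound (h2 : (2 : F) ≠ 0) (lam : Partition (n + 1)) :
    Module.Finite F ↥(EndRes F lam) ∧ Module.finrank F ↥(EndRes F lam) ≤ (remRows lam).card := by
  have hex : ∀ b : ℕ, ∃ f0 : ℕ × ℕ → ℕ, 1 ≤ b → ∀ v : (ℕ × ℕ → ℕ) → F,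
      Good lam.ht (n + 1 + 1) 1 b v →
      ((∃ c, 1 ≤ c ∧ c < n + 1 + 1 ∧ lam.ht c = b) → v f0 = 0) → ∀ f, v f = 0 := by
    intro b
    by_cases hb : 1 ≤ b
    · obtain ⟨f0, h⟩ := uniq_main h2 lam.ht_anti (lam.ht_zero) hb (n + 1) 1 (by omega)
      exact ⟨f0, fun _ => h⟩
    · exact ⟨Prod.fst, fun h => absurd h hb⟩
  choose f0 hf0 using hex
  let _ : AddCommGroup ↥(EndRes F lam) := Module.addCommMonoidToAddCommGroup F
  let L : ↥(EndRes F lam) →ₗ[F] (↥(remRows lam) → F) :=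
    LinearMap.pi fun b => (vb (lam := lam) b.1 (f0 b.1)).comp (EndRes F lam).toSubmodule.subtype
  have hL : Function.Injective L := by
    rw [injective_iff_map_eq_zero]
    intro Φ hΦ
    have hΦ' : ∀ b ∈ remRows lam, vb (lam := lam) b (f0 b) Φ.1 = 0 := fun b hb =>
      congrFun hΦ ⟨b, hb⟩
    have key : ∀ k b, n + 1 < b + k → ∀ (T : Placement lam) (τ : Tabloid (n + 1) lam.parts),
        b ≤ τ.1 (Fin.last n) → (Φ.1 (pe F T)).1 τ = 0 := by
      have hpos : ∀ (τ : Tabloid (n + 1) lam.parts) k, 1 ≤ lam.parts (τ.1 k) := by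
        intro τ k
        rw [← τ.2]
        exact card_pos.mpr ⟨k, by simp⟩
      intro k
      induction k with
      | zero =>
        intro b hb T τ hτ
        have := lam.row_le (hpos τ (Fin.last n))
        omega
      | succ k ih =>
        intro b hb T τ hτ
        rcases hτ.lt_or_eq with hlt | heq
        · exact ih (b + 1) (by omega) T τ hlt
        have hb1 : 1 ≤ b := by
          by_contra h0
          have := hpos τ (Fin.last n)
          rw [← heq, show b = 0 by omega, lam.parts_zero] at this
          omega
        have hg := vb_good Φ.2 (b := b) (fun T τ h => ih (b + 1) (by omega) T τ h)
        have hz := hf0 b hb1 _ hg (fun ⟨c, h1, _, h3⟩ => hΦ' b (remRows_of_ht hb1 h1 h3))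
        -- build f
        have hsurj : ∀ x : ℕ × ℕ, ∃ k, x ∈ lam.cells → T.pos k = x := by
          intro x
          by_cases hx : x ∈ lam.cells
          · obtain ⟨k, hk⟩ := T.surj x hx
            exact ⟨k, fun _ => hk⟩
          · exact ⟨Fin.last n, fun h => absurd h hx⟩
        choose s hs using hsurj
        have hsT : ∀ k, s (T.pos k) = k := fun k => T.inj (hs _ (T.mem k))
        have hc : Compat T (fun x => if s x = Fin.last n then 0 else τ.1 (s x)) := by
          intro k
          simp only [hsT]
          split_ifs with e
          · simp [e]
          · simp only [e, iff_false]
            intro e0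
            have := hpos τ k
            rw [e0, lam.parts_zero] at this
            omega
        have := hz (fun x => if s x = Fin.last n then 0 else τ.1 (s x))
        beta_reduce at this
        rw [vb_eq Φ.2 hc] at this
        rw [← this, ← ev_tab]
        congr 2
        funext k
        by_cases e : k = Fin.last n
        · rw [e, Function.update_self, heq]
        · rw [Function.update_of_ne e, Function.comp]
          simp only [hsT]
          rw [if_neg e]
    have hpe : ∀ T : Placement lam, Φ.1 (pe F T) = 0 := by
      intro T
      apply Subtype.ext
      apply Finsupp.ext
      intro τ
      exact key (n + 2) 0 (by omega) T τ (Nat.zero_le _)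
    apply Subtype.ext
    apply LinearMap.ext
    rintro ⟨x, hx⟩
    have hall : ∀ x (hx : x ∈ Specht F lam), Φ.1 ⟨x, hx⟩ = 0 := by
      intro x hx
      unfold Specht at hx
      induction hx using Submodule.span_induction with
      | mem x hx =>
        obtain ⟨T, rfl⟩ := hx
        exact hpe T
      | zero => exact map_zero _
      | add x y hx hy h1 h2 =>
        have := map_add Φ.1 (⟨x, hx⟩ : Specht F lam) ⟨y, hy⟩
        rw [h1, h2, add_zero] at this
        exact this
      | smul a x hx h1 =>
        have := map_smul Φ.1 a (⟨x, hx⟩ : Specht F lam)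
        rw [h1, smul_zero] at this
        exact this
    show Φ.1 ⟨x, hx⟩ = 0
    exact hall x hx
  refine ⟨Module.Finite.of_injective L hL, ?_⟩
  have := LinearMap.finrank_le_finrank_of_injective hL
  simpa using this

end Bound

section JM
variable {F : Type*} [Field F] {n : ℕ} {lam : Partition (n + 1)}

lemma col_card {N : ℕ} {μ : Partition N} (T : Placement μ) {c : ℕ} (hc : 1 ≤ c) :
    (univ.filter fun k => (T.pos k).2 = c).card = μ.ht c := by
  have h : (univ.filter fun k => (T.pos k).2 = c).card = (Icc 1 (μ.ht c)).card := by
    apply card_bij (fun k _ => (T.pos k).1)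
    · intro a ha
      rw [mem_filter] at ha
      obtain ⟨h1, h2, h3⟩ := T.mem a
      rw [mem_Icc]
      refine ⟨h1, (μ.le_ht h1 hc).mpr ?_⟩
      rw [← ha.2]
      exact h3
    · intro a ha b hb hab
      rw [mem_filter] at ha hb
      exact T.inj (Prod.ext hab (ha.2.trans hb.2.symm))
    · intro j hj
      rw [mem_Icc] at hj
      obtain ⟨k, hk⟩ := T.surj (j, c) ⟨hj.1, hc, (μ.le_ht hj.1 hc).mp hj.2⟩
      exact ⟨k, by simp [hk], by simp [hk]⟩
  rw [h, Nat.card_Icc]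
  omega

/-- The last Jucys-Murphy element acting on the permutation module. -/
noncomputable def jm (F : Type*) [Field F] {n : ℕ} (lam : Partition (n + 1)) :
    Module.End F (PermMod F (n + 1) lam.parts) :=
  ∑ i ∈ univ.erase (Fin.last n), permM F lam.parts (Equiv.swap i (Fin.last n))

lemma jm_apply (v : PermMod F (n + 1) lam.parts) :
    jm F lam v = ∑ i ∈ univ.erase (Fin.last n), permM F lam.parts (Equiv.swap i (Fin.last n)) v := by
  unfold jm
  rw [LinearMap.sum_apply]

lemma jm_poly (T : Placement lam) :
    jm F lam (polytabloid F T)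
      = ((((T.pos (Fin.last n)).2 : F) - (lam.ht (T.pos (Fin.last n)).2 : F)) • polytabloid F T)
        + ∑ x ∈ univ.filter (fun x => (T.pos (Fin.last n)).2 < (T.pos x).2),
            polytabloid F (T.perm (Equiv.swap x (Fin.last n))) := by
  obtain ⟨c, hc⟩ : ∃ c, (T.pos (Fin.last n)).2 = c := ⟨_, rfl⟩
  have hc1 : 1 ≤ c := hc ▸ (T.mem (Fin.last n)).2.1
  rw [hc, jm_apply]
  simp only [permM_poly]
  have hsplit : univ.erase (Fin.last n) = ((univ.filter fun x => (T.pos x).2 < c) ∪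
      ((univ.filter fun x => (T.pos x).2 = c).erase (Fin.last n))) ∪
      (univ.filter fun x => c < (T.pos x).2) := by
    ext x
    simp only [mem_erase, mem_union, mem_filter, mem_univ, true_and, and_true]
    constructor
    · intro h
      simp only [h, true_and, ne_eq, not_false_eq_true]
      omega
    · rintro ((h | h) | h) rfl
      · omega
      · exact h.1 rfl
      · omega
  rw [hsplit, sum_union, sum_union]
  · congr 1
    have h1 : ∑ x ∈ univ.filter (fun x => (T.pos x).2 < c),
        polytabloid F (T.perm (Equiv.swap x (Fin.last n))) = ((c : F) - 1) • polytabloid F T := by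
      have hm : ∀ x ∈ univ.filter (fun x => (T.pos x).2 < c), (T.pos x).2 ∈ Icc 1 (c - 1) := by
        intro x hx
        rw [mem_filter] at hx
        have := (T.mem x).2.1
        rw [mem_Icc]
        omega
      rw [← sum_fiberwise_of_maps_to hm]
      have : ∀ d ∈ Icc 1 (c - 1), ∑ x ∈ (univ.filter (fun x => (T.pos x).2 < c)).filter
          (fun x => (T.pos x).2 = d), polytabloid F (T.perm (Equiv.swap x (Fin.last n)))
          = polytabloid F T := by
        intro d hd
        rw [mem_Icc] at hd
        rw [garnir T (Fin.last n) d hd.1 (by omega)]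
        apply sum_congr _ (fun _ _ => rfl)
        ext x
        simp only [mem_filter, mem_univ, true_and]
        omega
      rw [sum_congr rfl this, sum_const, Nat.card_Icc, ← Nat.cast_smul_eq_nsmul F]
      congr 1
      rw [show c - 1 + 1 - 1 = c - 1 by omega, Nat.cast_sub hc1]
      simp
    have h2 : ∑ x ∈ (univ.filter fun x => (T.pos x).2 = c).erase (Fin.last n),
        polytabloid F (T.perm (Equiv.swap x (Fin.last n)))
          = (1 - (lam.ht c : F)) • polytabloid F T := by
      have : ∀ x ∈ (univ.filter fun x => (T.pos x).2 = c).erase (Fin.last n),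
          polytabloid F (T.perm (Equiv.swap x (Fin.last n))) = - polytabloid F T := by
        intro x hx
        rw [mem_erase, mem_filter] at hx
        exact poly_swap T hx.1 (hx.2.2.trans hc.symm)
      have hmem : Fin.last n ∈ univ.filter fun x => (T.pos x).2 = c := by
        rw [mem_filter]; exact ⟨mem_univ _, hc⟩
      have hpos : 1 ≤ lam.ht c := by
        rw [← col_card T hc1]
        exact card_pos.mpr ⟨_, hmem⟩
      rw [sum_congr rfl this, sum_const, card_erase_of_mem hmem, col_card T hc1,
        ← Nat.cast_smul_eq_nsmul F, smul_neg, ← neg_smul, Nat.cast_sub hpos]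
      congr 1
      simp
    rw [h1, h2, ← add_smul]
    congr 1
    ring
  · rw [disjoint_left]
    intro x hx hx'
    rw [mem_erase, mem_filter] at hx'
    rw [mem_filter] at hx
    omega
  · rw [disjoint_left]
    intro x hx hx'
    rw [mem_union, mem_erase, mem_filter, mem_filter] at hx
    rw [mem_filter] at hx'
    omega

open Polynomial in
/-- The candidate minimal polynomial, truncated to columns at least `c`. -/
noncomputable def Qpol (F : Type*) [Field F] {n : ℕ} (lam : Partition (n + 1)) (c : ℕ) : F[X] :=
  ∏ i ∈ (remRows lam).filter (fun i => c ≤ lam.parts i), (X - C ((lam.parts i : F) - (i : F)))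

lemma Qpol_dvd (c : ℕ) : Qpol F lam (c + 1) ∣ Qpol F lam c := by
  apply prod_dvd_prod_of_subset
  intro i hi
  rw [mem_filter] at hi ⊢
  exact ⟨hi.1, by omega⟩

lemma aeval_dvd_zero {p q : Polynomial F} (h : p ∣ q) {v : PermMod F (n + 1) lam.parts}
    (hv : Polynomial.aeval (jm F lam) p v = 0) : Polynomial.aeval (jm F lam) q v = 0 := by
  obtain ⟨r, rfl⟩ := h
  rw [mul_comm, map_mul, Module.End.mul_apply, hv, map_zero]

lemma Qpol_kill : ∀ k c, n + 1 < c + k → 1 ≤ c → ∀ T : Placement lam, c ≤ (T.pos (Fin.last n)).2 →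
    Polynomial.aeval (jm F lam) (Qpol F lam c) (polytabloid F T) = 0 := by
  intro k
  induction k with
  | zero =>
    intro c hc _ T hT
    have h1 := (T.mem (Fin.last n)).2.2
    have h2 := lam.parts_le (T.pos (Fin.last n)).1
    omega
  | succ k ih =>
    intro c hc hc1 T hT
    have ih' := ih (c + 1) (by omega) (by omega)
    rcases hT.lt_or_eq with hlt | heq
    · exact aeval_dvd_zero (Qpol_dvd c) (ih' T hlt)
    by_cases hh : ∀ i, 1 ≤ i → (c ≤ lam.parts i ↔ c + 1 ≤ lam.parts i)
    · obtain ⟨T', h1, h2⟩ := poly_colswap (R := F) T hc1 (show 1 ≤ c + 1 by omega) hh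
      rw [← h1]
      apply aeval_dvd_zero (Qpol_dvd c)
      apply ih'
      rw [h2, ← heq, Equiv.swap_apply_left]
    · push Not at hh
      obtain ⟨i, hi1, hi⟩ := hh
      have hi : lam.parts i = c := by omega
      have hp : lam.parts (lam.ht c) = c := by
        have h1 : i ≤ lam.ht c := (lam.le_ht hi1 hc1).mpr hi.ge
        have h2 := lam.antitone (show 0 < i by omega) h1
        have h3 := (lam.le_ht (show 1 ≤ lam.ht c by omega) hc1).mp le_rfl
        omega
      have hq1 : 1 ≤ lam.ht c := by
        by_contra h0
        rw [show lam.ht c = 0 by omega, lam.parts_zero] at hp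
        omega
      have hrem : lam.ht c ∈ remRows lam := remRows_of_ht hq1 hc1 rfl
      have hd : Qpol F lam (c + 1) * (Polynomial.X - Polynomial.C ((c : F) - (lam.ht c : F))) ∣
          Qpol F lam c := by
        unfold Qpol
        have := prod_dvd_prod_of_subset (M := Polynomial F)
          (insert (lam.ht c) ((remRows lam).filter (fun i => c + 1 ≤ lam.parts i)))
          ((remRows lam).filter (fun i => c ≤ lam.parts i))
          (fun i => (Polynomial.X - Polynomial.C ((lam.parts i : F) - (i : F)))) (by
            intro j hj
            rw [mem_insert, mem_filter] at hj
            rw [mem_filter]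
            rcases hj with rfl | hj
            · exact ⟨hrem, hp.ge⟩
            · exact ⟨hj.1, by omega⟩)
        rw [prod_insert (by rw [mem_filter]; omega), hp, mul_comm] at this
        exact this
      apply aeval_dvd_zero hd
      rw [map_mul, Module.End.mul_apply]
      have : Polynomial.aeval (jm F lam) (Polynomial.X - Polynomial.C ((c : F) - (lam.ht c : F)))
          (polytabloid F T) = ∑ x ∈ univ.filter (fun x => c < (T.pos x).2),
            polytabloid F (T.perm (Equiv.swap x (Fin.last n))) := by
        rw [map_sub, Polynomial.aeval_X, Polynomial.aeval_C, LinearMap.sub_apply, jm_poly, ← heq,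
          Module.algebraMap_end_apply, add_sub_cancel_left]
      rw [this, map_sum]
      apply sum_eq_zero
      intro x hx
      rw [mem_filter] at hx
      apply ih'
      rw [perm_swap_pos, Equiv.swap_apply_right]
      exact hx.2

open Polynomial in
/-- The minimal polynomial. -/
noncomputable def Ppol (F : Type*) [Field F] {n : ℕ} (lam : Partition (n + 1)) : F[X] :=
  ∏ i ∈ remRows lam, (X - C ((lam.parts i : F) - (i : F)))

lemma Ppol_kill (T : Placement lam) :
    Polynomial.aeval (jm F lam) (Ppol F lam) (polytabloid F T) = 0 := by
  have := Qpol_kill (F := F) (n + 1) 1 (by omega) le_rfl T (T.mem _).2.1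
  unfold Qpol at this
  rw [filter_true_of_mem] at this
  · exact this
  · intro i hi
    have := (mem_remRows.mp hi).2
    omega

end JM

section Indep
variable {F : Type*} [Field F] {n : ℕ} {lam : Partition (n + 1)}

lemma ev_jm (g : Fin (n + 1) → ℕ) (v : PermMod F (n + 1) lam.parts) :
    ev lam.parts g (jm F lam v) =
      ∑ y ∈ univ.erase (Fin.last n), ev lam.parts (g ∘ Equiv.swap y (Fin.last n)) v := by
  rw [jm_apply, map_sum]
  apply sum_congr rfl
  intro y _
  rw [ev_perm]

lemma ev_poly_self (T : Placement lam) :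
    ev lam.parts (fun k => (T.pos k).1) (polytabloid F T) = 1 := by
  rw [ev_poly, sum_eq_single 1]
  · simp
  · intro π hπ hne
    rw [if_neg]
    intro e
    apply hne
    ext1 k
    exact T.inj (Prod.ext (congrFun e k) (mem_colStab.mp hπ k))
  · intro h
    exfalso
    apply h
    rw [mem_colStab]
    intro k
    rfl

lemma ev_poly_ne {T : Placement lam} {g : Fin (n + 1) → ℕ}
    (h : ev lam.parts g (polytabloid F T) ≠ 0) :
    ∃ π : Equiv.Perm (Fin (n + 1)), (∀ k, (T.pos (π k)).2 = (T.pos k).2) ∧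
      ∀ k, g k = (T.pos (π k)).1 := by
  rw [ev_poly] at h
  obtain ⟨π, hπ, h1⟩ := exists_ne_zero_of_sum_ne_zero h
  refine ⟨π, mem_colStab.mp hπ, fun k => ?_⟩
  by_contra hne
  apply h1
  rw [if_neg]
  intro e
  exact hne (congrFun e k).symm

/-- The column of the node in row `q` carries admissible entries. -/
def GoodCol (T : Placement lam) (q : ℕ) (g : Fin (n + 1) → ℕ) : Prop :=
  (∃ y, (T.pos y).2 = lam.parts q ∧ g y = q) ∧ ∀ y, (T.pos y).2 = lam.parts q → g y ≤ q

open Classical in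
/-- The number of bad columns. -/
noncomputable def badNum (T : Placement lam) (k : ℕ) (q : ℕ → ℕ) (g : Fin (n + 1) → ℕ) : ℕ :=
  ((Ico 1 k).filter fun j => ¬ GoodCol T (q j) g).card

/-- The tabloids used to detect powers. -/
def zTab (T : Placement lam) (x : ℕ → Fin (n + 1)) : ℕ → Fin (n + 1) → ℕ
  | 0 => fun k => (T.pos k).1
  | m + 1 => zTab T x m ∘ Equiv.swap (x (m + 1)) (Fin.last n)

structure Setup (T : Placement lam) (k : ℕ) (q : ℕ → ℕ) (x : ℕ → Fin (n + 1)) : Prop where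
  mem : ∀ j < k, q j ∈ remRows lam
  lt : ∀ i j, i < j → j < k → q j < q i
  pos : ∀ j < k, T.pos (x j) = (q j, lam.parts (q j))
  zero : x 0 = Fin.last n

variable {T : Placement lam} {k : ℕ} {q : ℕ → ℕ} {x : ℕ → Fin (n + 1)}

lemma Setup.col_lt (S : Setup T k q x) {i j : ℕ} (hij : i < j) (hj : j < k) :
    lam.parts (q i) < lam.parts (q j) := by
  have h1 := S.lt i j hij hj
  have h2 := (mem_remRows.mp (S.mem j hj)).2
  have h3 := lam.antitone (show 0 < q j + 1 by omega) (show q j + 1 ≤ q i by omega)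
  omega

lemma Setup.col_inj (S : Setup T k q x) {i j : ℕ} (hi : i < k) (hj : j < k)
    (h : lam.parts (q i) = lam.parts (q j)) : i = j := by
  rcases lt_trichotomy i j with hlt | he | hgt
  · have := S.col_lt hlt hj; omega
  · exact he
  · have := S.col_lt hgt hi; omega

lemma Setup.row_le (S : Setup T k q x) {j : ℕ} (hj : j < k) {y : Fin (n + 1)}
    (hy : (T.pos y).2 = lam.parts (q j)) : (T.pos y).1 ≤ q j := by
  by_contra hn
  have h2 := (mem_remRows.mp (S.mem j hj)).2
  have h3 := lam.antitone (show 0 < q j + 1 by omega) (show q j + 1 ≤ (T.pos y).1 by omega)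
  have h4 := (T.mem y).2.2
  omega

lemma Setup.last (S : Setup T k q x) (hk : 0 < k) :
    T.pos (Fin.last n) = (q 0, lam.parts (q 0)) := by
  rw [← S.zero]
  exact S.pos 0 hk

lemma Setup.ne_last (S : Setup T k q x) {j : ℕ} (hj : j < k) (hj1 : 1 ≤ j) {y : Fin (n + 1)}
    (hy : (T.pos y).2 = lam.parts (q j)) : y ≠ Fin.last n := by
  rintro rfl
  rw [S.last (by omega)] at hy
  have := S.col_inj (by omega) hj hy
  omega

lemma Setup.bad_zero (S : Setup T k q x) {g : Fin (n + 1) → ℕ}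
    (h : ev lam.parts g (polytabloid F T) ≠ 0) : badNum T k q g = 0 := by
  classical
  obtain ⟨π, h1, h2⟩ := ev_poly_ne h
  unfold badNum
  rw [card_eq_zero, filter_eq_empty_iff]
  intro j hj
  rw [mem_Ico] at hj
  rw [not_not]
  refine ⟨⟨π.symm (x j), ?_, ?_⟩, ?_⟩
  · rw [← h1, Equiv.apply_symm_apply, S.pos j hj.2]
  · rw [h2, Equiv.apply_symm_apply, S.pos j hj.2]
  · intro y hy
    rw [h2]
    exact S.row_le hj.2 ((h1 y).trans hy)

lemma Setup.bad_step (S : Setup T k q x) (g : Fin (n + 1) → ℕ) (y : Fin (n + 1)) :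
    badNum T k q g ≤ badNum T k q (g ∘ Equiv.swap y (Fin.last n)) + 1 := by
  classical
  unfold badNum
  have hsub : (Ico 1 k).filter (fun j => ¬ GoodCol T (q j) g) ⊆
      (Ico 1 k).filter (fun j => ¬ GoodCol T (q j) (g ∘ Equiv.swap y (Fin.last n))) ∪
      (Ico 1 k).filter (fun j => lam.parts (q j) = (T.pos y).2) := by
    intro j hj
    rw [mem_filter, mem_Ico] at hj
    rw [mem_union, mem_filter, mem_filter, mem_Ico]
    by_cases hy : lam.parts (q j) = (T.pos y).2
    · exact Or.inr ⟨hj.1, hy⟩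
    · left
      refine ⟨hj.1, fun hg => hj.2 ?_⟩
      have key : ∀ z, (T.pos z).2 = lam.parts (q j) →
          (g ∘ Equiv.swap y (Fin.last n)) z = g z := by
        intro z hz
        rw [Function.comp, Equiv.swap_apply_of_ne_of_ne]
        · rintro rfl
          exact hy hz.symm
        · exact S.ne_last hj.1.2 hj.1.1 hz
      obtain ⟨⟨z, hz, hz'⟩, h2⟩ := hg
      refine ⟨⟨z, hz, ?_⟩, fun w hw => ?_⟩
      · rw [← key z hz, hz']
      · rw [← key w hw]
        exact h2 w hw
  refine (card_le_card hsub).trans ((card_union_le _ _).trans ?_)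
  apply Nat.add_le_add_left
  rw [card_le_one]
  intro a ha b hb
  rw [mem_filter, mem_Ico] at ha hb
  exact S.col_inj ha.1.2 hb.1.2 (ha.2.trans hb.2.symm)

lemma Setup.vanish (S : Setup T k q x) : ∀ i (g : Fin (n + 1) → ℕ), i < badNum T k q g →
    ev lam.parts g ((jm F lam ^ i) (polytabloid F T)) = 0 := by
  intro i
  induction i with
  | zero =>
    intro g hg
    by_contra h
    rw [pow_zero, Module.End.one_apply] at h
    have := S.bad_zero h
    omega
  | succ i ih =>
    intro g hg
    rw [pow_succ', Module.End.mul_apply, ev_jm]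
    apply sum_eq_zero
    intro y _
    apply ih
    have := S.bad_step g y
    omega

lemma Setup.x_inj (S : Setup T k q x) {i j : ℕ} (hi : i < k) (hj : j < k) (h : x i = x j) :
    i = j := by
  apply S.col_inj hi hj
  have := S.pos i hi
  rw [h, S.pos j hj] at this
  exact (congrArg Prod.snd this).symm

lemma Setup.z (S : Setup T k q x) : ∀ m, m < k → zTab T x m (Fin.last n) = q m ∧
    (∀ j, 1 ≤ j → j ≤ m → zTab T x m (x j) = q (j - 1)) ∧
    ∀ y, (∀ j, j ≤ m → y ≠ x j) → zTab T x m y = (T.pos y).1 := by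
  intro m
  induction m with
  | zero =>
    intro hk
    refine ⟨?_, ?_, ?_⟩
    · show (T.pos _).1 = _
      rw [S.last hk]
    · intro j h1 h2
      omega
    · intro y _
      rfl
  | succ m ih =>
    intro hk
    obtain ⟨h1, h2, h3⟩ := ih (by omega)
    have hne : ∀ j, 1 ≤ j → j < k → x j ≠ Fin.last n := by
      intro j hj1 hj e
      rw [← S.zero] at e
      have := S.x_inj hj (by omega) e
      omega
    refine ⟨?_, ?_, ?_⟩
    · rw [zTab, Function.comp, Equiv.swap_apply_right, h3, S.pos _ hk]
      intro j hj e
      have := S.x_inj hk (by omega) e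
      omega
    · intro j hj1 hj
      rw [zTab, Function.comp]
      by_cases e : j = m + 1
      · rw [e, Equiv.swap_apply_left, h1]
        rfl
      · rw [Equiv.swap_apply_of_ne_of_ne, h2 j hj1 (by omega)]
        · intro e'
          exact e (S.x_inj (by omega) hk e')
        · exact hne j hj1 (by omega)
    · intro y hy
      rw [zTab, Function.comp, Equiv.swap_apply_of_ne_of_ne, h3]
      · intro j hj
        exact hy j (by omega)
      · exact hy _ le_rfl
      · rw [← S.zero]
        exact hy 0 (by omega)

lemma Setup.bad_z_swap (S : Setup T k q x) {m : ℕ} (hm : m < k) {y : Fin (n + 1)}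
    (hy : y ≠ x m) : m ≤ badNum T k q (zTab T x m ∘ Equiv.swap y (Fin.last n)) := by
  classical
  obtain ⟨h1, h2, h3⟩ := S.z m hm
  unfold badNum
  have hsub : Icc 1 m ⊆ (Ico 1 k).filter
      (fun j => ¬ GoodCol T (q j) (zTab T x m ∘ Equiv.swap y (Fin.last n))) := by
    intro j hj
    rw [mem_Icc] at hj
    have hjk : j < k := by omega
    rw [mem_filter, mem_Ico]
    refine ⟨⟨hj.1, hjk⟩, fun hg => ?_⟩
    have hcol : (T.pos (x j)).2 = lam.parts (q j) := by rw [S.pos j hjk]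
    have hl := S.ne_last hjk hj.1 hcol
    by_cases e : y = x j
    · obtain ⟨⟨w, hw, hw'⟩, -⟩ := hg
      have hjm : j < m := by
        rcases hj.2.lt_or_eq with h | h
        · exact h
        · rw [h] at e; exact absurd e hy
      have hwl := S.ne_last hjk hj.1 hw
      by_cases ew : w = x j
      · rw [ew, Function.comp, e, Equiv.swap_apply_left, h1] at hw'
        have := S.lt j m hjm hm
        omega
      · rw [Function.comp, Equiv.swap_apply_of_ne_of_ne (by rw [e]; exact ew) hwl, h3] at hw'
        · apply ew
          apply T.inj
          rw [S.pos j hjk]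
          exact Prod.ext hw' hw
        · intro i hi ei
          rw [ei, S.pos i (by omega)] at hw
          have := S.col_inj (by omega) hjk hw
          rw [this] at ei
          exact ew ei
    · have := hg.2 (x j) hcol
      rw [Function.comp, Equiv.swap_apply_of_ne_of_ne (Ne.symm e) hl, h2 j hj.1 hj.2] at this
      have := S.lt (j - 1) j (by omega) hjk
      omega
  have := card_le_card hsub
  rw [Nat.card_Icc] at this
  omega

lemma Setup.bad_z (S : Setup T k q x) {m : ℕ} (hm : m < k) : m ≤ badNum T k q (zTab T x m) := by
  rcases Nat.eq_zero_or_pos m with h | h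
  · omega
  · have := S.bad_z_swap hm (y := Fin.last n) (by
      rw [← S.zero]
      intro e
      have := S.x_inj (by omega) hm e
      omega)
    rw [Equiv.swap_self] at this
    exact this

lemma Setup.one (S : Setup T k q x) : ∀ m, m < k →
    ev lam.parts (zTab T x m) ((jm F lam ^ m) (polytabloid F T)) = 1 := by
  intro m
  induction m with
  | zero =>
    intro _
    rw [pow_zero, Module.End.one_apply]
    exact ev_poly_self T
  | succ m ih =>
    intro hm
    have hxl : x (m + 1) ≠ Fin.last n := by
      apply S.ne_last hm (by omega)
      rw [S.pos _ hm]
    rw [pow_succ', Module.End.mul_apply, ev_jm, sum_eq_single (x (m + 1))]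
    · rw [zTab, Function.comp_assoc, ← Equiv.coe_trans, ← Equiv.Perm.mul_def, Equiv.swap_mul_self]
      exact ih (by omega)
    · intro y hy hne
      apply S.vanish
      have := S.bad_z_swap hm hne
      omega
    · intro h
      exact absurd (mem_erase.mpr ⟨hxl, mem_univ _⟩) h

lemma exists_setup (lam : Partition (n + 1)) :
    ∃ (T : Placement lam) (q : ℕ → ℕ) (x : ℕ → Fin (n + 1)), Setup T (remRows lam).card q x := by
  obtain ⟨T0⟩ := exists_placement lam
  obtain ⟨q, hq1, hq2⟩ : ∃ q : ℕ → ℕ, (∀ j < (remRows lam).card, q j ∈ remRows lam) ∧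
      ∀ i j, i < j → j < (remRows lam).card → q j < q i := by
    refine ⟨fun j => if h : j < (remRows lam).card then
      (remRows lam).orderEmbOfFin rfl (Fin.rev ⟨j, h⟩) else 0, ?_, ?_⟩
    · intro j hj
      beta_reduce
      rw [dif_pos hj]
      exact orderEmbOfFin_mem _ _ _
    · intro i j hij hj
      beta_reduce
      rw [dif_pos hj, dif_pos (hij.trans hj)]
      rw [OrderEmbedding.lt_iff_lt, Fin.rev_lt_rev]
      exact hij
  have hcell : ∀ j < (remRows lam).card, (q j, lam.parts (q j)) ∈ lam.cells := by
    intro j hj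
    have := mem_remRows.mp (hq1 j hj)
    exact ⟨by simp only; omega, by simp only; omega, le_rfl⟩
  obtain ⟨T, hT⟩ : ∃ T : Placement lam, 0 < (remRows lam).card →
      T.pos (Fin.last n) = (q 0, lam.parts (q 0)) := by
    by_cases h : 0 < (remRows lam).card
    · obtain ⟨y, hy⟩ := T0.surj _ (hcell 0 h)
      refine ⟨T0.perm (Equiv.swap y (Fin.last n)), fun _ => ?_⟩
      rw [perm_swap_pos, Equiv.swap_apply_right, hy]
    · exact ⟨T0, fun h' => absurd h' h⟩
  have hx : ∀ j, ∃ y, (j < (remRows lam).card → T.pos y = (q j, lam.parts (q j))) ∧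
      (j = 0 → y = Fin.last n) := by
    intro j
    rcases Nat.eq_zero_or_pos j with rfl | h0
    · exact ⟨Fin.last n, hT, fun _ => rfl⟩
    · by_cases h : j < (remRows lam).card
      · obtain ⟨y, hy⟩ := T.surj _ (hcell j h)
        exact ⟨y, fun _ => hy, fun h => by omega⟩
      · exact ⟨Fin.last n, fun h' => absurd h' h, fun _ => rfl⟩
  choose x hx1 hx2 using hx
  exact ⟨T, q, x, hq1, hq2, hx1, hx2 0 rfl⟩

theorem aeval_ne {P : Polynomial F} (hP : P ≠ 0) (hd : P.natDegree < (remRows lam).card) :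
    ∃ T : Placement lam, Polynomial.aeval (jm F lam) P (polytabloid F T) ≠ 0 := by
  obtain ⟨T, q, x, S⟩ := exists_setup lam
  refine ⟨T, fun h => hP ?_⟩
  have h1 := congrArg (ev lam.parts (zTab T x P.natDegree)) h
  rw [Polynomial.aeval_eq_sum_range, LinearMap.sum_apply, map_sum, map_zero, sum_range_succ,
    sum_eq_zero, zero_add, LinearMap.smul_apply, map_smul, S.one _ hd, smul_eq_mul, mul_one] at h1
  · exact Polynomial.leadingCoeff_eq_zero.mp h1
  · intro i hi
    rw [mem_range] at hi
    rw [LinearMap.smul_apply, map_smul, S.vanish, smul_zero]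
    have := S.bad_z hd
    omega

end Indep

section Final
variable {F : Type*} [Field F] {n : ℕ} {lam : Partition (n + 1)}

lemma permM_mul {N : ℕ} {c : ℕ → ℕ} (σ τ : Equiv.Perm (Fin N)) (v : PermMod F N c) :
    permM F c (σ * τ) v = permM F c σ (permM F c τ v) := by
  unfold permM
  rw [Finsupp.lmapDomain_apply, Finsupp.lmapDomain_apply, Finsupp.lmapDomain_apply,
    ← Finsupp.mapDomain_comp]
  rfl

lemma jm_comm (π : Equiv.Perm (Fin (n + 1))) (hπ : π (Fin.last n) = Fin.last n)
    (v : PermMod F (n + 1) lam.parts) :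
    jm F lam (permM F lam.parts π v) = permM F lam.parts π (jm F lam v) := by
  rw [jm_apply, jm_apply, map_sum]
  symm
  apply sum_bij (fun i _ => π i)
  · intro i hi
    rw [mem_erase] at hi ⊢
    refine ⟨fun e => hi.1 (π.injective (e.trans hπ.symm)), mem_univ _⟩
  · intro a _ b _ e
    exact π.injective e
  · intro b hb
    rw [mem_erase] at hb
    refine ⟨π.symm b, mem_erase.mpr ⟨fun e => hb.1 ?_, mem_univ _⟩, by simp⟩
    rw [← hπ, ← e]
    simp
  · intro i _
    rw [← permM_mul, ← permM_mul]
    congr 2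
    conv_rhs => rw [← hπ]
    rw [Equiv.swap_apply_apply]
    simp

lemma jm_mem (v : PermMod F (n + 1) lam.parts) (hv : v ∈ Specht F lam) :
    jm F lam v ∈ Specht F lam := by
  rw [jm_apply]
  apply Submodule.sum_mem
  intro i _
  have : Specht F lam ≤ (Specht F lam).comap (permM F lam.parts (Equiv.swap i (Fin.last n))) := by
    conv_lhs => unfold Specht
    rw [Submodule.span_le]
    rintro _ ⟨T, rfl⟩
    show permM F lam.parts _ (polytabloid F T) ∈ Specht F lam
    rw [permM_poly]
    exact Submodule.subset_span ⟨_, rfl⟩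
  exact this hv

/-- The last Jucys-Murphy element acting on the restricted Specht module. -/
noncomputable def jmE (F : Type*) [Field F] {n : ℕ} (lam : Partition (n + 1)) :
    ↥(EndRes F lam) :=
  ⟨(jm F lam).restrict jm_mem, by
    intro π hπ x y hxy
    rw [LinearMap.coe_restrict_apply, LinearMap.coe_restrict_apply, hxy, jm_comm π hπ]⟩

lemma aeval_jmE (q : Polynomial F) (v : ↥(Specht F lam)) :
    ((Polynomial.aeval (jmE F lam) q).1 v).1 = Polynomial.aeval (jm F lam) q v.1 := by
  induction q using Polynomial.induction_on generalizing v with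
  | C a =>
    rw [Polynomial.aeval_C, Polynomial.aeval_C]
    rfl
  | add p q hp hq =>
    rw [map_add, map_add, LinearMap.add_apply, ← hp, ← hq]
    rfl
  | monomial m a h =>
    rw [pow_succ, ← mul_assoc, map_mul, map_mul (Polynomial.aeval (jm F lam)),
      Module.End.mul_apply, Polynomial.aeval_X, Polynomial.aeval_X]
    exact h ((jmE F lam).1 v)

lemma aeval_jmE_eq_zero (q : Polynomial F) :
    Polynomial.aeval (jmE F lam) q = 0 ↔
      ∀ T : Placement lam, Polynomial.aeval (jm F lam) q (polytabloid F T) = 0 := by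
  constructor
  · intro h T
    have := aeval_jmE q (pe F T)
    rw [h] at this
    exact this.symm
  · intro h
    apply Subtype.ext
    apply LinearMap.ext
    intro v
    apply Subtype.ext
    rw [aeval_jmE]
    have : Specht F lam ≤ LinearMap.ker (Polynomial.aeval (jm F lam) q) := by
      unfold Specht
      rw [Submodule.span_le]
      rintro _ ⟨T, rfl⟩
      exact h T
    exact this v.2

lemma Ppol_monic : (Ppol F lam).Monic :=
  Polynomial.monic_prod_of_monic _ _ fun _ _ => Polynomial.monic_X_sub_C _

lemma Ppol_natDegree : (Ppol F lam).natDegree = (remRows lam).card := by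
  unfold Ppol
  rw [Polynomial.natDegree_prod_of_monic _ _ fun _ _ => Polynomial.monic_X_sub_C _]
  simp only [Polynomial.natDegree_X_sub_C, sum_const, smul_eq_mul, mul_one]

lemma aeval_jmE_ker (q : Polynomial F) :
    Polynomial.aeval (jmE F lam) q = 0 ↔ Ppol F lam ∣ q := by
  have hP : Polynomial.aeval (jmE F lam) (Ppol F lam) = 0 :=
    (aeval_jmE_eq_zero _).mpr Ppol_kill
  constructor
  · intro h
    rw [← Polynomial.modByMonic_eq_zero_iff_dvd Ppol_monic]
    by_contra hne
    have hk : 0 < (remRows lam).card := by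
      by_contra h0
      have h1 : (Ppol F lam).natDegree = 0 := by rw [Ppol_natDegree]; omega
      rw [Ppol_monic.natDegree_eq_zero.mp h1, Polynomial.modByMonic_one] at hne
      exact hne rfl
    obtain ⟨T, hT⟩ := aeval_ne (lam := lam) hne (by
      rw [← Ppol_natDegree (F := F)]
      apply Polynomial.natDegree_modByMonic_lt _ Ppol_monic
      intro e
      have := Ppol_natDegree (F := F) (lam := lam)
      rw [e, Polynomial.natDegree_one] at this
      omega)
    apply hT
    apply (aeval_jmE_eq_zero _).mp
    rw [← h]
    conv_rhs => rw [← Polynomial.modByMonic_add_div q (Ppol F lam)]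
    rw [map_add, map_mul, hP, zero_mul, add_zero]
  · rintro ⟨r, rfl⟩
    rw [map_mul, hP, zero_mul]

lemma quot_equiv (h2 : (2 : F) ≠ 0) :
    Nonempty ((Polynomial F ⧸ Ideal.span {Ppol F lam}) ≃ₐ[F] ↥(EndRes F lam)) := by
  let φ : (Polynomial F ⧸ Ideal.span {Ppol F lam}) →ₐ[F] ↥(EndRes F lam) :=
    Ideal.Quotient.liftₐ _ (Polynomial.aeval (jmE F lam)) (fun a ha =>
      (aeval_jmE_ker a).mpr (Ideal.mem_span_singleton.mp ha))
  let _ : AddCommGroup ↥(EndRes F lam) := Module.addCommMonoidToAddCommGroup F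
  have hinj : Function.Injective φ.toLinearMap := by
    rw [injective_iff_map_eq_zero]
    intro a ha
    obtain ⟨q, rfl⟩ := Ideal.Quotient.mk_surjective a
    rw [Ideal.Quotient.eq_zero_iff_mem, Ideal.mem_span_singleton]
    exact (aeval_jmE_ker q).mp ha
  obtain ⟨hfin, hle⟩ := end_bound h2 lam
  have hfin' : Module.Finite F (Polynomial F ⧸ Ideal.span {Ppol F lam}) :=
    Module.Finite.of_injective φ.toLinearMap hinj
  have hdim : Module.finrank F (Polynomial F ⧸ Ideal.span {Ppol F lam}) = (remRows lam).card := by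
    rw [finrank_quotient_span_eq_natDegree' Ppol_monic, Ppol_natDegree]
  have hle' := LinearMap.finrank_le_finrank_of_injective hinj
  have hsurj := (LinearMap.injective_iff_surjective_of_finrank_eq_finrank
    (le_antisymm hle' (by rw [hdim]; exact hle))).mp hinj
  exact ⟨AlgEquiv.ofBijective φ ⟨hinj, hsurj⟩⟩

/-- Chinese remainder theorem, as an algebra isomorphism. -/
lemma crt_equiv {ι : Type*} [Fintype ι] (a : ι → F) (ha : Function.Injective a) (m : ι → ℕ) :
    Nonempty ((Polynomial F ⧸ Ideal.span {∏ i, (Polynomial.X - Polynomial.C (a i)) ^ m i}) ≃ₐ[F]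
      ((i : ι) → Polynomial F ⧸ Ideal.span ({Polynomial.X ^ m i} : Set (Polynomial F)))) := by
  have hco : ∀ i j, i ≠ j → IsCoprime ((Polynomial.X - Polynomial.C (a i)) ^ m i)
      ((Polynomial.X - Polynomial.C (a j)) ^ m j) := fun i j hij =>
    (Polynomial.pairwise_coprime_X_sub_C ha hij).pow
  have h1 := Ideal.iInf_span_singleton hco
  have e1 := Ideal.quotientEquivAlgOfEq F h1.symm
  have e2 : (Polynomial F ⧸ ⨅ i, Ideal.span {(Polynomial.X - Polynomial.C (a i)) ^ m i}) ≃ₐ[F]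
      ((i : ι) → Polynomial F ⧸ Ideal.span {(Polynomial.X - Polynomial.C (a i)) ^ m i}) :=
    { Ideal.quotientInfRingEquivPiQuotient
        (fun i => Ideal.span {(Polynomial.X - Polynomial.C (a i)) ^ m i})
        (fun i j hij => (Ideal.isCoprime_span_singleton_iff _ _).mpr (hco i j hij)) with
      commutes' := fun _ => rfl }
  have e3 : ∀ i, (Polynomial F ⧸ Ideal.span {(Polynomial.X - Polynomial.C (a i)) ^ m i}) ≃ₐ[F]
      (Polynomial F ⧸ Ideal.span ({Polynomial.X ^ m i} : Set (Polynomial F))) := fun i =>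
    Ideal.quotientEquivAlg _ _ (Polynomial.algEquivAevalXAddC (a i)) (by
      rw [Ideal.map_span, Set.image_singleton]
      congr 2
      simp)
  exact ⟨(e1.trans e2).trans (AlgEquiv.piCongrRight e3)⟩

lemma Ppol_eq (p : ℕ) [CharP F p] :
    Ppol F lam = ∏ r : ↥(remResSet lam p), (Polynomial.X -
      Polynomial.C (ZMod.castHom (dvd_refl p) F r.1)) ^ remResCount lam p r.1 := by
  have h : ∀ i ∈ remRows lam, (((lam.parts i : ℤ) - (i : ℤ) : ℤ) : ZMod p) ∈ remResSet lam p :=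
    fun i hi => mem_image_of_mem _ hi
  rw [Ppol, ← prod_fiberwise_of_maps_to h, ← prod_coe_sort (remResSet lam p)]
  apply prod_congr rfl
  rintro ⟨r, hr⟩ _
  unfold remResCount
  rw [← prod_const]
  apply prod_congr rfl
  intro i hi
  rw [mem_filter] at hi
  rw [← hi.2, map_intCast]
  simp

end Final

/-- Let `F` be a field of characteristic `p ≠ 2` and `λ` a partition of
`n+1`.  Then the blocks of `End_{FΣ_n}(S^λ↓_{Σ_n})` are parametrized by the `p`-residues
of the removable nodes of `[λ]`: the algebra is isomorphic to the product, over the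
`p`-residues `r` of removable nodes, of the truncated polynomial rings `F[x]/(x^{m_r})`,
where `m_r` is the number of removable nodes of `[λ]` of `p`-residue `r` (in particular
each block has `F`-dimension `m_r`). -/
theorem stmt2 (F : Type*) [Field F] (p : ℕ) [CharP F p] (hp : p ≠ 2)
    {n : ℕ} (lam : Partition (n + 1)) :
    Nonempty (↥(EndRes F lam) ≃ₐ[F]
      ((r : ↥(remResSet lam p)) →
        Polynomial F ⧸ Ideal.span ({Polynomial.X ^ (remResCount lam p r.1)} : Set (Polynomial F)))) := by
  have h2 : (2 : F) ≠ 0 := Ring.two_ne_zero (by rwa [ringChar.eq F p])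
  obtain ⟨e1⟩ := quot_equiv (lam := lam) h2
  obtain ⟨e2⟩ := crt_equiv (F := F) (fun r : ↥(remResSet lam p) => ZMod.castHom (dvd_refl p) F r.1)
    (fun r s h => Subtype.ext (ZMod.castHom_injective F h)) (fun r => remResCount lam p r.1)
  rw [← Ppol_eq p] at e2
  exact ⟨e1.symm.trans e2⟩

end CarterPayne
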